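/- arXiv:2010.15765 — 4 statements merged into one kernel-verified Lean document; each statement's English description precedes it below -/
import Mathlib

section
/- (Optimal colorful fractional Helly theorem, Theorem 1.5.) Let d ≥ 1 and let F_1, …, F_{d+1} be finite nonempty families of convex sets in ℝ^d (possibly with repetitions) of sizes n_1, …, n_{d+1} respectively. Let α ∈ (0,1]. If at least α·n_1·n_2⋯n_{d+1} of the colorful (d+1)-tuples have a nonempty intersection, then there exists i ∈ {1,…,d+1} such that F_i contains a subfamily of size at least (1 − (1−α)^{1/(d+1)})·n_i whose members have a nonempty common intersection. -/
open scoped BigOperators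

/-- If fewer than `∏ i, k i` points of a grid are prescribed, some nonzero function on the grid
vanishes at all of them and is, on each line in direction `i`, a polynomial of degree less
than `k i`; in particular it vanishes on such a line as soon as it has `k i` zeros there. -/
theorem exists_ne_zero_of_card_lt_prod {ι : Type*} [Fintype ι] [DecidableEq ι]
    (n k : ι → ℕ) (hk : ∀ i, k i ≤ n i) (T : Finset (∀ i, Fin (n i)))
    (hT : T.card < ∏ i, k i) :
    ∃ h : (∀ i, Fin (n i)) → ℝ, (∃ t, h t ≠ 0) ∧ (∀ t ∈ T, h t = 0) ∧
      ∀ i t, k i ≤ (Finset.univ.filter fun v ↦ h (Function.update t i v) = 0).card →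
        ∀ v, h (Function.update t i v) = 0 := by
  let L : ((∀ i, Fin (k i)) → ℝ) →ₗ[ℝ] (T → ℝ) :=
    { toFun := fun c t ↦ ∑ e, c e * ∏ i, ((t.1 i : ℕ) : ℝ) ^ (e i : ℕ)
      map_add' := fun a b ↦ by ext t; simp [add_mul, Finset.sum_add_distrib]
      map_smul' := fun a b ↦ by ext t; simp [Finset.mul_sum, mul_assoc] }
  have hL : LinearMap.ker L ≠ ⊥ := L.ker_ne_bot_of_finrank_lt <| by
    simpa [Module.finrank_fintype_fun_eq_card] using hT
  obtain ⟨c, hcL, hc0⟩ := (Submodule.ne_bot_iff _).1 hL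
  refine ⟨fun t ↦ ∑ e, c e * ∏ i, ((t i : ℕ) : ℝ) ^ (e i : ℕ), ?_, ?_, ?_⟩
  · by_contra! hzero
    let m : (∀ i, Fin (k i)) → ι →₀ ℕ := fun e ↦ Finsupp.equivFunOnFinite.symm fun i ↦ (e i : ℕ)
    have hm : Function.Injective m := fun a b hab ↦ by
      funext i
      exact Fin.ext (by simpa [m] using DFunLike.congr_fun hab i)
    let P : MvPolynomial ι ℝ := ∑ e, MvPolynomial.monomial (m e) (c e)
    obtain ⟨e₀, he₀⟩ := Function.ne_iff.1 hc0
    have hkpos : ∀ i, 0 < k i := fun i ↦ (e₀ i).pos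
    have hP : P = 0 := by
      refine MvPolynomial.eq_zero_of_eval_zero_at_prod_finset P
        (fun i ↦ Finset.univ.image fun v : Fin (n i) ↦ ((v : ℕ) : ℝ)) (fun i ↦ ?_) fun x hx ↦ ?_
      · have hcard : (Finset.univ.image fun v : Fin (n i) ↦ ((v : ℕ) : ℝ)).card = n i := by
          rw [Finset.card_image_of_injective _ fun a b hab ↦ Fin.ext (Nat.cast_injective hab),
            Finset.card_univ, Fintype.card_fin]
        rw [hcard]
        refine lt_of_lt_of_le ?_ (hk i)
        refine (MvPolynomial.degreeOf_lt_iff (hkpos i)).2 fun s hs ↦ ?_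
        obtain ⟨e, -, he⟩ := Finset.mem_biUnion.1 (MvPolynomial.support_sum hs)
        have hse : s = m e := by
          simpa using MvPolynomial.support_monomial_subset he
        simp [hse, m]
      · choose t ht using fun i ↦ Finset.mem_image.1 (hx i)
        obtain rfl : x = fun i ↦ ((t i : ℕ) : ℝ) := funext fun i ↦ (ht i).2.symm
        rw [← hzero t]
        simp [P, m, MvPolynomial.eval_monomial, Finsupp.prod_fintype]
    apply he₀
    have hcoeff := congrArg (MvPolynomial.coeff (m e₀)) hP
    simpa [P, MvPolynomial.coeff_sum, MvPolynomial.coeff_monomial, hm.eq_iff] using hcoeff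
  · intro t ht
    exact congrFun (LinearMap.mem_ker.1 hcL) ⟨t, ht⟩
  · intro i t hcard v
    let Q : Polynomial ℝ := ∑ e : ∀ i, Fin (k i),
      Polynomial.C (c e * ∏ j ∈ Finset.univ.erase i, ((t j : ℕ) : ℝ) ^ (e j : ℕ)) *
        Polynomial.X ^ (e i : ℕ)
    have hQ : ∀ v : Fin (n i), Q.eval ((v : ℕ) : ℝ) =
        ∑ e, c e * ∏ j, ((Function.update t i v j : ℕ) : ℝ) ^ (e j : ℕ) := fun v ↦ by
      simp only [Q, Polynomial.eval_finsetSum, Polynomial.eval_mul, Polynomial.eval_C,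
        Polynomial.eval_pow, Polynomial.eval_X]
      refine Finset.sum_congr rfl fun e _ ↦ ?_
      rw [← Finset.prod_erase_mul _ _ (Finset.mem_univ i), mul_assoc]
      congr 2
      · refine Finset.prod_congr rfl fun j hj ↦ ?_
        rw [Function.update_of_ne (Finset.ne_of_mem_erase hj)]
      · simp
    have hdeg : Q.degree < k i := by
      refine (Polynomial.degree_sum_le _ _).trans_lt ?_
      refine (Finset.sup_lt_iff (WithBot.bot_lt_coe _)).2 fun e _ ↦ ?_
      exact (Polynomial.degree_C_mul_X_pow_le _ _).trans_lt (by exact_mod_cast (e i).2)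
    have hQ0 : Q = 0 := by
      refine Polynomial.eq_zero_of_degree_lt_of_eval_index_eq_zero
        (v := fun v : Fin (n i) ↦ ((v : ℕ) : ℝ)) _
        (Nat.cast_injective.comp Fin.val_injective).injOn
        (hdeg.trans_le (Nat.cast_le.2 hcard)) fun v hv ↦ ?_
      rw [hQ]
      exact (Finset.mem_filter.1 hv).2
    exact (hQ v).symm.trans (by rw [hQ0, Polynomial.eval_zero])

/-- If `p` is a point of least norm in the intersection of `d + 1` convex sets in dimension `d`,
then one of the sets can be omitted without decreasing the least norm. -/
theorem exists_forall_norm_le_of_omit {E ι : Type*} [NormedAddCommGroup E] [NormedSpace ℝ E]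
    [FiniteDimensional ℝ E] [Fintype ι] (hι : Fintype.card ι = Module.finrank ℝ E + 1)
    {C : ι → Set E} (hC : ∀ i, Convex ℝ (C i)) {p : E} (hp : ∀ i, p ∈ C i)
    (hmin : ∀ x, (∀ i, x ∈ C i) → ‖p‖ ≤ ‖x‖) :
    ∃ i, ∀ x, (∀ j, j ≠ i → x ∈ C j) → ‖p‖ ≤ ‖x‖ := by
  classical
  by_contra! hcon
  choose y hy hyp using hcon
  let D : Option ι → Set E := fun o ↦ o.elim (Metric.ball 0 ‖p‖) C
  have hD : (⋂ o ∈ (Finset.univ : Finset (Option ι)), D o).Nonempty := by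
    refine Convex.helly_theorem (𝕜 := ℝ) (by simp [hι]) ?_ fun I _ hI ↦ ?_
    · rintro (_ | i) -
      · exact convex_ball _ _
      · exact hC i
    · by_cases hnone : none ∈ I
      · obtain ⟨i, hi⟩ : ∃ i, some i ∉ I := by
          by_contra! hall
          have huniv : I = Finset.univ := by
            ext (_ | i) <;> simp [hnone, hall]
          rw [huniv] at hI
          simp [hι] at hI
        refine ⟨y i, Set.mem_iInter₂.2 ?_⟩
        rintro (_ | j) hj
        · simpa [D] using hyp i
        · exact hy i j fun hji ↦ hi (hji ▸ hj)
      · refine ⟨p, Set.mem_iInter₂.2 ?_⟩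
        rintro (_ | j) hj
        · exact absurd hj hnone
        · exact hp j
  obtain ⟨x, hx⟩ := hD
  rw [Set.mem_iInter₂] at hx
  have hball : ‖x‖ < ‖p‖ := by simpa [D] using hx none (Finset.mem_univ _)
  exact (hmin x fun i ↦ hx (some i) (Finset.mem_univ _)).not_gt hball

/-- A lower bound for the number of colorful tuples with empty intersection, for compact convex
sets, when no more than `r i` sets of color `i` have a common point. -/
theorem prod_sub_le_card_not_nonempty_iInter {E ι : Type*} [NormedAddCommGroup E]
    [NormedSpace ℝ E] [StrictConvexSpace ℝ E] [FiniteDimensional ℝ E] [Fintype ι]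
    (hι : Fintype.card ι = Module.finrank ℝ E + 1) (n r : ι → ℕ)
    (G : ∀ i, Fin (n i) → Set E) (hconv : ∀ i j, Convex ℝ (G i j))
    (hcomp : ∀ i j, IsCompact (G i j))
    (hr : ∀ i (s : Finset (Fin (n i))), (⋂ j ∈ s, G i j).Nonempty → s.card ≤ r i) :
    ∏ i, (n i - r i) ≤ Set.ncard {t : ∀ i, Fin (n i) | ¬ (⋂ i, G i (t i)).Nonempty} := by
  classical
  by_contra! hlt
  rw [Set.ncard_eq_toFinset_card'] at hlt
  obtain ⟨h, ⟨t₀, ht₀⟩, hT, hline⟩ := exists_ne_zero_of_card_lt_prod n (fun i ↦ n i - r i)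
    (fun i ↦ Nat.sub_le _ _) _ hlt
  have hne : ∀ t, h t ≠ 0 → (⋂ i, G i (t i)).Nonempty := fun t ht ↦ by
    by_contra hcon
    exact ht (hT t (Set.mem_toFinset.2 (Set.not_nonempty_iff_eq_empty.1 hcon)))
  have : Nonempty ι := Fintype.card_pos_iff.1 (by lia)
  have hmin : ∀ t, h t ≠ 0 → ∃ p, (∀ i, p ∈ G i (t i)) ∧
      ∀ x, (∀ i, x ∈ G i (t i)) → ‖p‖ ≤ ‖x‖ := fun t ht ↦ by
    have hcompact : IsCompact (⋂ i, G i (t i)) :=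
      (hcomp (Classical.arbitrary ι) _).of_isClosed_subset
        (isClosed_iInter fun i ↦ (hcomp i (t i)).isClosed) (Set.iInter_subset _ _)
    obtain ⟨p, hp, hpm⟩ := hcompact.exists_isMinOn (hne t ht) continuous_norm.continuousOn
    exact ⟨p, Set.mem_iInter.1 hp, fun x hx ↦ hpm (Set.mem_iInter.2 hx)⟩
  choose! p hpG hpmin using hmin
  obtain ⟨t, ht, htmax⟩ := Finset.exists_max_image (Finset.univ.filter fun t ↦ h t ≠ 0)
    (fun t ↦ ‖p t‖) ⟨t₀, by simpa using ht₀⟩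
  simp only [Finset.mem_filter, Finset.mem_univ, true_and] at ht htmax
  obtain ⟨i, hi⟩ := exists_forall_norm_le_of_omit hι (fun i ↦ hconv i (t i)) (hpG t ht)
    (hpmin t ht)
  have hmem : ∀ v, h (Function.update t i v) ≠ 0 → p t ∈ G i v := fun v hv ↦ by
    have hq := hpG _ hv
    have hq' : ∀ j, j ≠ i → p (Function.update t i v) ∈ G j (t j) := fun j hj ↦ by
      simpa [Function.update_of_ne hj] using hq j
    have hnorm : ‖p t‖ = ‖p (Function.update t i v)‖ := (hi _ hq').antisymm (htmax _ hv)
    have heq : p t = p (Function.update t i v) := by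
      by_contra hcon
      refine ((norm_midpoint_lt_iff hnorm).2 hcon).not_ge (hi _ fun j hj ↦ ?_)
      rw [smul_add]
      exact hconv j (t j) (hpG t ht j) (hq' j hj) (by norm_num) (by norm_num) (by norm_num)
    rw [heq]
    simpa using hq i
  have hcard := hr i (Finset.univ.filter fun v ↦ ¬ h (Function.update t i v) = 0)
    ⟨p t, Set.mem_iInter₂.2 fun v hv ↦ hmem v (Finset.mem_filter.1 hv).2⟩
  have hadd := Finset.card_filter_add_card_filter_not (s := Finset.univ)
    fun v ↦ h (Function.update t i v) = 0
  rw [Finset.card_univ, Fintype.card_fin] at hadd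
  exact ht (by simpa using hline i t (by lia) (t i))

/-- **The optimal colorful fractional Helly theorem** (Theorem 1.5).
Families with repetitions are modeled as indexed families
`F i : Fin (n i) → Set (EuclideanSpace ℝ (Fin d))` of convex sets. If at least
`α · n 1 ⋯ n (d+1)` of the colorful `(d+1)`-tuples have a nonempty intersection,
then some `F i` contains a subfamily of size at least `(1 - (1-α)^(1/(d+1))) · n i`
with a nonempty intersection. -/
theorem optimal_colorful_fractional_helly
    (d : ℕ) (hd : 1 ≤ d) (n : Fin (d + 1) → ℕ) (hn : ∀ i, 1 ≤ n i)
    (F : ∀ i : Fin (d + 1), Fin (n i) → Set (EuclideanSpace ℝ (Fin d)))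
    (hconv : ∀ i j, Convex ℝ (F i j))
    (α : ℝ) (hα0 : 0 < α) (hα1 : α ≤ 1)
    (hcount : α * ∏ i, (n i : ℝ) ≤
      (Set.ncard {t : ∀ i : Fin (d + 1), Fin (n i) | (⋂ i, F i (t i)).Nonempty} : ℝ)) :
    ∃ i : Fin (d + 1), ∃ s : Finset (Fin (n i)),
      (1 - (1 - α) ^ (1 / ((d : ℝ) + 1))) * (n i : ℝ) ≤ (s.card : ℝ) ∧
      (⋂ j ∈ s, F i j).Nonempty := by
  classical
  by_contra! hcon
  set β : ℝ := (1 - α) ^ (1 / ((d : ℝ) + 1)) with hβ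
  have hβ0 : 0 ≤ β := Real.rpow_nonneg (by linarith) _
  have hβpow : β ^ (d + 1) = 1 - α := by
    rw [hβ, one_div]
    exact_mod_cast Real.rpow_inv_natCast_pow (n := d + 1) (by linarith : (0 : ℝ) ≤ 1 - α)
      (by lia)
  let S : Set (∀ i : Fin (d + 1), Fin (n i)) := {t | (⋂ i, F i (t i)).Nonempty}
  choose! w hw using fun t (ht : t ∈ S) ↦ (show (⋂ i, F i (t i)).Nonempty from ht)
  let G : ∀ i : Fin (d + 1), Fin (n i) → Set (EuclideanSpace ℝ (Fin d)) :=
    fun i j ↦ convexHull ℝ (Set.image w {t | t ∈ S ∧ t i = j})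
  have hGF : ∀ i j, G i j ⊆ F i j := fun i j ↦ by
    refine convexHull_min ?_ (hconv i j)
    rintro _ ⟨t, ⟨ht, rfl⟩, rfl⟩
    exact Set.mem_iInter.1 (hw t ht) i
  have hmax : ∀ i, ∃ r : ℕ, (r : ℝ) < (1 - β) * n i ∧
      ∀ s : Finset (Fin (n i)), (⋂ j ∈ s, G i j).Nonempty → s.card ≤ r := fun i ↦ by
    obtain ⟨s, hs, hsmax⟩ := Finset.exists_max_image
      (Finset.univ.filter fun s : Finset (Fin (n i)) ↦ (⋂ j ∈ s, F i j).Nonempty)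
      Finset.card ⟨∅, by simp⟩
    simp only [Finset.mem_filter, Finset.mem_univ, true_and] at hs hsmax
    refine ⟨s.card, lt_of_not_ge fun hle ↦ hs.ne_empty (hcon i s hle),
      fun u hu ↦ hsmax u (hu.mono (Set.iInter₂_mono fun j _ ↦ hGF i j))⟩
  choose r hr hrG using hmax
  have hmain := prod_sub_le_card_not_nonempty_iInter
    (E := EuclideanSpace ℝ (Fin d)) (by simp) n r G
    (fun i j ↦ convex_convexHull ℝ _)
    (fun i j ↦ Set.Finite.isCompact_convexHull ℝ (Set.toFinite _)) hrG
  have hsub : {t : ∀ i, Fin (n i) | ¬ (⋂ i, G i (t i)).Nonempty} ⊆ Sᶜ := fun t ht htS ↦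
    ht ⟨w t, Set.mem_iInter.2 fun i ↦ subset_convexHull ℝ _ ⟨t, ⟨htS, rfl⟩, rfl⟩⟩
  have hle : ∏ i, (n i - r i) ≤ Sᶜ.ncard := hmain.trans (Set.ncard_le_ncard hsub)
  have hcompl : (S.ncard : ℝ) + Sᶜ.ncard = ∏ i, (n i : ℝ) := by
    have := Set.ncard_add_ncard_compl S
    rw [Nat.card_eq_fintype_card, Fintype.card_pi] at this
    simp only [Fintype.card_fin] at this
    exact_mod_cast this
  have hlt : ∀ i, β * n i < ((n i - r i : ℕ) : ℝ) := fun i ↦ by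
    have h1 : (n i : ℝ) - r i ≤ ((n i - r i : ℕ) : ℝ) := by
      rw [sub_le_iff_le_add]
      exact_mod_cast (by lia : n i ≤ n i - r i + r i)
    linarith [hr i]
  have hprod : (1 - α) * ∏ i, (n i : ℝ) < ∏ i, ((n i - r i : ℕ) : ℝ) := by
    have heq : (1 - α) * ∏ i, (n i : ℝ) = ∏ i, (β * n i) := by
      simp [Finset.prod_mul_distrib, hβpow]
    rw [heq]
    rcases hβ0.eq_or_lt with hzero | hpos
    · rw [← hzero]
      simp only [zero_mul, Finset.prod_const, Finset.card_univ, Fintype.card_fin,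
        zero_pow (Nat.succ_ne_zero d)]
      exact Finset.prod_pos fun i _ ↦ by simpa [← hzero] using hlt i
    · exact Finset.prod_lt_prod_of_nonempty
        (fun i _ ↦ mul_pos hpos (by exact_mod_cast hn i)) (fun i _ ↦ hlt i)
        Finset.univ_nonempty
  have hle' : ∏ i, ((n i - r i : ℕ) : ℝ) ≤ Sᶜ.ncard := by exact_mod_cast hle
  have hcount' : α * ∏ i, (n i : ℝ) ≤ S.ncard := hcount
  linarith
end

section
/- (Theorem 1.6, reformulation of the optimal colorful fractional Helly theorem for d-representable complexes.) Let d ≥ 1 and let K be a d-representable simplicial complex whose vertex set N is partitioned into d+1 disjoint subsets N = N_1 ⊔ ⋯ ⊔ N_{d+1} with n_i := |N_i| ≥ 1. Let α ∈ (0,1]. If K contains at least α·n_1⋯n_{d+1} colorful d-faces, then there exists i ∈ {1,…,d+1} such that dim K[N_i] ≥ (1 − (1−α)^{1/(d+1)})·n_i − 1. -/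
open scoped BigOperators

/-- A (finite abstract) simplicial complex: a family of finite subsets of the vertex
type closed under taking subsets. -/
def IsComplex {V : Type*} [DecidableEq V] (K : Finset (Finset V)) : Prop :=
  ∀ A ∈ K, ∀ B ⊆ A, B ∈ K

open Finset in
/-- A subset of a grid `∏ i, N i` that percolates, in the sense that every nonempty part `S` of
its complement `R` has a point on an axis-parallel line in direction `i` meeting `S` in at most
`r i` points, has at least `∏ i, (#(N i) - r i)` elements. -/
theorem prod_card_sub_le_card_sdiff_of_percolates {ι V : Type*} [Fintype ι] [DecidableEq ι]
    [Fintype V] [DecidableEq V] (N : ι → Finset V) (r : ι → ℕ) (R : Finset (ι → V))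
    (hR : R ⊆ Fintype.piFinset N)
    (h : ∀ S ⊆ R, S.Nonempty →
      ∃ f ∈ S, ∃ i, #{w ∈ N i | Function.update f i w ∈ S} ≤ r i) :
    ∏ i, (#(N i) - r i) ≤ #(Fintype.piFinset N \ R) := by
  classical
  obtain ⟨t, ht⟩ : ∃ t : V → ℚ, Function.Injective t :=
    ⟨fun v => ((Fintype.equivFin V v : ℕ) : ℚ), fun v w hvw =>
      (Fintype.equivFin V).injective (Fin.ext (Nat.cast_injective hvw))⟩
  let L : ((∀ i, Fin (#(N i) - r i)) → ℚ) →ₗ[ℚ] ((Fintype.piFinset N \ R : Finset (ι → V)) → ℚ) :=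
    { toFun := fun c f => ∑ e, c e * ∏ i, t (f.1 i) ^ (e i : ℕ)
      map_add' := fun c c' => by
        funext f
        simp [add_mul, sum_add_distrib]
      map_smul' := fun a c => by
        funext f
        simp [mul_sum, mul_assoc] }
  suffices hL : Function.Injective L by
    have := LinearMap.finrank_le_finrank_of_injective hL
    simpa only [Module.finrank_fintype_fun_eq_card, Fintype.card_pi, Fintype.card_fin,
      Fintype.card_coe] using this
  rw [← LinearMap.ker_eq_bot, LinearMap.ker_eq_bot']
  intro c hc
  set Q : (ι → V) → ℚ := fun f => ∑ e, c e * ∏ i, t (f i) ^ (e i : ℕ) with hQ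
  have hQ_out : ∀ f ∈ Fintype.piFinset N, f ∉ R → Q f = 0 := fun f hf hfR =>
    congrFun hc ⟨f, mem_sdiff.2 ⟨hf, hfR⟩⟩
  have hQ_zero : ∀ f ∈ Fintype.piFinset N, Q f = 0 := by
    by_contra! ⟨f₀, hf₀, hne⟩
    have hS : ({f ∈ R | Q f ≠ 0} : Finset _).Nonempty :=
      ⟨f₀, mem_filter.2 ⟨by_contra fun hR' => hne (hQ_out f₀ hf₀ hR'), hne⟩⟩
    obtain ⟨f, hf, i, hi⟩ := h _ (filter_subset _ _) hS
    obtain ⟨hfR, hfQ⟩ := mem_filter.1 hf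
    have hfN := Fintype.mem_piFinset.1 (hR hfR)
    let q : Polynomial ℚ := ∑ e : (∀ i, Fin (#(N i) - r i)),
      Polynomial.monomial (e i : ℕ) (c e * ∏ j ∈ univ.erase i, t (f j) ^ (e j : ℕ))
    have hq_eval : ∀ w, q.eval (t w) = Q (Function.update f i w) := by
      intro w
      simp only [q, hQ, Polynomial.eval_finsetSum, Polynomial.eval_monomial]
      refine sum_congr rfl fun e _ => ?_
      have herase : ∏ j ∈ univ.erase i, t (Function.update f i w j) ^ (e j : ℕ) =
          ∏ j ∈ univ.erase i, t (f j) ^ (e j : ℕ) :=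
        prod_congr rfl fun j hj => by rw [Function.update_of_ne (ne_of_mem_erase hj)]
      rw [← mul_prod_erase univ _ (mem_univ i), Function.update_self, herase]
      ring
    have hq_deg : q.degree < (#(N i) - r i : ℕ) :=
      Polynomial.mem_degreeLT.1 <| Submodule.sum_mem _ fun e _ =>
        Polynomial.monomial_coe_mem_degreeLT _ _
    have hcard : #(N i) - r i ≤
        #(({w ∈ N i | Function.update f i w ∉ ({f ∈ R | Q f ≠ 0} : Finset _)}).image t) := by
      rw [card_image_of_injective _ ht]
      have := card_filter_add_card_filter_not (s := N i)
        (fun w => Function.update f i w ∈ ({f ∈ R | Q f ≠ 0} : Finset _))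
      omega
    have hq : q = 0 := by
      refine Polynomial.eq_zero_of_degree_lt_of_eval_finset_eq_zero _
        (hq_deg.trans_le (by exact_mod_cast hcard)) fun x hx => ?_
      obtain ⟨w, hw, rfl⟩ := mem_image.1 hx
      obtain ⟨hwN, hw⟩ := mem_filter.1 hw
      rw [hq_eval]
      by_contra hne
      have hmem : Function.update f i w ∈ Fintype.piFinset N := by
        refine Fintype.mem_piFinset.2 fun j => ?_
        rcases eq_or_ne j i with rfl | hj
        · simpa using hwN
        · simpa [hj] using hfN j
      exact hw (mem_filter.2 ⟨by_contra fun hR' => hne (hQ_out _ hmem hR'), hne⟩)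
    have := hq_eval (f i)
    rw [hq, Function.update_eq_self, Polynomial.eval_zero] at this
    exact hfQ this.symm
  let P : MvPolynomial ι ℚ := ∑ e : (∀ i, Fin (#(N i) - r i)),
    MvPolynomial.monomial (Finsupp.equivFunOnFinite.symm fun i => (e i : ℕ)) (c e)
  have hinj : Function.Injective fun (e : ∀ i, Fin (#(N i) - r i)) =>
      Finsupp.equivFunOnFinite.symm fun i => (e i : ℕ) := by
    intro e e' hee
    funext i
    exact Fin.ext (congrFun (Finsupp.equivFunOnFinite.symm.injective hee) i)
  funext e₀
  have hpos : ∀ i, 0 < #(N i) := fun i => by have := (e₀ i).2; omega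
  have hP : P = 0 := by
    refine MvPolynomial.eq_zero_of_eval_zero_at_prod_finset P (fun i => (N i).image t) ?_ ?_
    · intro i
      rw [card_image_of_injective _ ht, MvPolynomial.degreeOf_lt_iff (hpos i)]
      intro m hm
      obtain ⟨e, -, he⟩ := mem_biUnion.1 (MvPolynomial.support_sum hm)
      rw [mem_singleton.1 (MvPolynomial.support_monomial_subset he)]
      have := (e i).2
      simp only [Finsupp.equivFunOnFinite_symm_apply_apply]
      omega
    · intro x hx
      choose f hf hfx using fun i => mem_image.1 (hx i)
      obtain rfl : (fun i => t (f i)) = x := funext hfx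
      rw [← hQ_zero f (Fintype.mem_piFinset.2 hf)]
      simp [P, hQ, MvPolynomial.eval_monomial, Finsupp.prod_fintype]
  have := congrArg (MvPolynomial.coeff (Finsupp.equivFunOnFinite.symm fun i => (e₀ i : ℕ))) hP
  simp only [P, MvPolynomial.coeff_sum, MvPolynomial.coeff_monomial, MvPolynomial.coeff_zero] at this
  rw [sum_eq_single e₀ (fun e _ he => if_neg fun heq => he (hinj heq)) (by simp)] at this
  rwa [if_pos rfl] at this

/-- A finite family of convex sets can be shrunk to closed convex sets with the same nerve. -/
theorem exists_isClosed_convex_same_nerve {E V : Type*} [AddCommGroup E] [Module ℝ E]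
    [TopologicalSpace E] [IsTopologicalAddGroup E] [ContinuousSMul ℝ E] [T2Space E] [Finite V]
    (F : V → Set E) (hF : ∀ v, Convex ℝ (F v)) :
    ∃ G : V → Set E, (∀ v, Convex ℝ (G v)) ∧ (∀ v, IsClosed (G v)) ∧
      ∀ A : Finset V, (⋂ v ∈ A, F v).Nonempty ↔ (⋂ v ∈ A, G v).Nonempty := by
  let x : {A : Finset V // (⋂ v ∈ A, F v).Nonempty} → E := fun A => A.2.some
  have hx : ∀ A, ∀ v ∈ A.1, x A ∈ F v := fun A v hv => Set.mem_iInter₂.1 A.2.some_mem v hv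
  have hsub : ∀ v, convexHull ℝ (x '' {A | v ∈ A.1}) ⊆ F v := fun v =>
    convexHull_min (by rintro _ ⟨A, hA, rfl⟩; exact hx A v hA) (hF v)
  refine ⟨fun v => convexHull ℝ (x '' {A | v ∈ A.1}), fun v => convex_convexHull ℝ _,
    fun v => (Set.toFinite _).isClosed_convexHull ℝ, fun A => ⟨fun hA => ?_, fun hA => ?_⟩⟩
  · exact ⟨x ⟨A, hA⟩, Set.mem_iInter₂.2 fun v hv =>
      subset_convexHull ℝ _ (Set.mem_image_of_mem x hv)⟩
  · exact hA.mono (Set.iInter₂_mono fun v _ => hsub v)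

/-- The point of least norm in the intersection of `dim E + 1` convex sets is already the point of
least norm in the intersection of all but one of them. -/
theorem exists_forall_norm_le_of_card_eq_finrank_add_one {E ι : Type*} [NormedAddCommGroup E]
    [NormedSpace ℝ E] [FiniteDimensional ℝ E] [Fintype ι]
    (hι : Fintype.card ι = Module.finrank ℝ E + 1) (C : ι → Set E) (hC : ∀ i, Convex ℝ (C i))
    (p : E) (hp : ∀ i, p ∈ C i) (hmin : ∀ x, (∀ i, x ∈ C i) → ‖p‖ ≤ ‖x‖) :
    ∃ j, ∀ x, (∀ i, i ≠ j → x ∈ C i) → ‖p‖ ≤ ‖x‖ := by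
  by_contra! hcon
  choose q hq hqp using hcon
  have hinter : (⋂ o ∈ (Finset.univ : Finset (Option ι)),
      Option.elim o (Metric.ball (0 : E) ‖p‖) C).Nonempty := by
    refine Convex.helly_theorem' (𝕜 := ℝ) ?_ fun I _ hI => ?_
    · rintro (_ | i) -
      · exact convex_ball 0 _
      · exact hC i
    · obtain ⟨o, ho⟩ : ∃ o, o ∉ I := by
        by_contra! hall
        rw [Finset.eq_univ_of_forall hall, Finset.card_univ, Fintype.card_option] at hI
        omega
      rcases o with _ | j
      · refine ⟨p, Set.mem_iInter₂.2 ?_⟩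
        rintro (_ | i) hi
        · exact absurd hi ho
        · exact hp i
      · refine ⟨q j, Set.mem_iInter₂.2 ?_⟩
        rintro (_ | i) hi
        · simpa using hqp j
        · exact hq j i (by rintro rfl; exact ho hi)
  obtain ⟨y, hy⟩ := hinter
  simp only [Finset.mem_univ, Set.iInter_true, Set.mem_iInter] at hy
  have hlt : ‖y‖ < ‖p‖ := by simpa using hy none
  exact hlt.not_ge (hmin y fun i => hy (some i))

/-- In a strictly convex space, a convex set has at most one point of least norm. -/
theorem Convex.eq_of_forall_norm_le {E : Type*} [NormedAddCommGroup E] [NormedSpace ℝ E]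
    [StrictConvexSpace ℝ E] {s : Set E} (hs : Convex ℝ s) {p q : E} (hp : p ∈ s) (hq : q ∈ s)
    (hmin : ∀ x ∈ s, ‖p‖ ≤ ‖x‖) (hqp : ‖q‖ ≤ ‖p‖) : q = p := by
  by_contra hne
  have hlt : ‖(1 / 2 : ℝ) • q + (1 / 2 : ℝ) • p‖ < ‖p‖ :=
    norm_combo_lt_of_ne hqp le_rfl hne (by norm_num) (by norm_num) (by norm_num)
  exact hlt.not_ge (hmin _ (hs hq hp (by norm_num) (by norm_num) (by norm_num)))

open Finset in
/-- Among the transversals of `dim E + 1` families of convex sets in `E`, such that the `i`-th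
family has no more than `r i` members with a common point, at least `∏ i, (#(N i) - r i)` have
empty intersection. -/
theorem prod_card_sub_le_card_transversals_not_nonempty {E ι V : Type*} [NormedAddCommGroup E]
    [InnerProductSpace ℝ E] [FiniteDimensional ℝ E] [Fintype ι] [DecidableEq ι] [Fintype V]
    [DecidableEq V] (hι : Fintype.card ι = Module.finrank ℝ E + 1)
    (F : V → Set E) (hF : ∀ v, Convex ℝ (F v)) (hF_closed : ∀ v, IsClosed (F v))
    (N : ι → Finset V) (r : ι → ℕ)
    (hr : ∀ i, ∀ A ⊆ N i, (⋂ v ∈ A, F v).Nonempty → #A ≤ r i)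
    (R : Finset (ι → V)) (hR : ∀ f, f ∈ R ↔ f ∈ Fintype.piFinset N ∧ (⋂ i, F (f i)).Nonempty) :
    ∏ i, (#(N i) - r i) ≤ #(Fintype.piFinset N \ R) := by
  have hproper : ProperSpace E := FiniteDimensional.proper_real E
  have hmin : ∀ f : ι → V, ∃ p : E, f ∈ R →
      (∀ i, p ∈ F (f i)) ∧ ∀ x, (∀ i, x ∈ F (f i)) → ‖p‖ ≤ ‖x‖ := by
    intro f
    by_cases hf : f ∈ R
    · obtain ⟨p, hp, hdist⟩ := (isClosed_iInter fun i => hF_closed (f i)).exists_infDist_eq_dist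
        ((hR f).1 hf).2 0
      refine ⟨p, fun _ => ⟨Set.mem_iInter.1 hp, fun x hx => ?_⟩⟩
      have := Metric.infDist_le_dist_of_mem (x := (0 : E)) (Set.mem_iInter.2 hx)
      rwa [hdist, dist_zero_left, dist_zero_left] at this
    · exact ⟨0, fun h => absurd h hf⟩
  choose p hp using hmin
  refine prod_card_sub_le_card_sdiff_of_percolates N r R (fun f hf => ((hR f).1 hf).1)
    fun S hSR hS => ?_
  obtain ⟨f, hfS, hmax⟩ := exists_max_image S (fun f => ‖p f‖) hS
  obtain ⟨hpf, hpf_min⟩ := hp f (hSR hfS)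
  obtain ⟨j, hj⟩ := exists_forall_norm_le_of_card_eq_finrank_add_one hι (fun i => F (f i))
    (fun i => hF (f i)) (p f) hpf hpf_min
  refine ⟨f, hfS, j, hr j _ (filter_subset _ _) ⟨p f, Set.mem_iInter₂.2 fun w hw => ?_⟩⟩
  have hwS := (mem_filter.1 hw).2
  have hpw := (hp _ (hSR hwS)).1
  have hs : Convex ℝ (⋂ (i) (_ : i ≠ j), F (f i)) :=
    convex_iInter₂ fun i _ => hF (f i)
  have heq : p (Function.update f j w) = p f := by
    refine hs.eq_of_forall_norm_le (Set.mem_iInter₂.2 fun i _ => hpf i)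
      (Set.mem_iInter₂.2 fun i hi => ?_) (fun x hx => hj x (Set.mem_iInter₂.1 hx)) (hmax _ hwS)
    simpa [hi] using hpw i
  simpa [heq] using hpw j

/-- **Theorem 1.6**: the optimal colorful fractional Helly theorem for
`d`-representable complexes. The vertex set of `K` is the fintype `V`,
colored by `color : V → Fin (d+1)` (so `N i` is the fiber over `i`, assumed nonempty);
`K` is `d`-representable, i.e. it is the nerve of a family of convex sets in `ℝ^d`
indexed by `V`. If at least `α · n 1 ⋯ n (d+1)` of the colorful `d`-faces are in `K`,
then for some `i` the induced subcomplex `K[N i]` has dimension at least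
`(1 - (1-α)^(1/(d+1))) · n i - 1`. -/
theorem optimal_colorful_fractional_helly_representable
    (d : ℕ) (hd : 1 ≤ d) {V : Type} [Fintype V] [DecidableEq V]
    (K : Finset (Finset V)) (hK : IsComplex K)
    (hrep : ∃ F : V → Set (EuclideanSpace ℝ (Fin d)), (∀ v, Convex ℝ (F v)) ∧
      ∀ A : Finset V, A ∈ K ↔ (⋂ v ∈ A, F v).Nonempty)
    (color : V → Fin (d + 1))
    (hne : ∀ i, 1 ≤ (Finset.univ.filter fun v => color v = i).card)
    (α : ℝ) (hα0 : 0 < α) (hα1 : α ≤ 1)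
    (hcount : α * ∏ i, ((Finset.univ.filter fun v => color v = i).card : ℝ) ≤
      ((K.filter fun A => ∀ i, (A.filter fun v => color v = i).card = 1).card : ℝ)) :
    ∃ i : Fin (d + 1), ∃ A ∈ K, (∀ v ∈ A, color v = i) ∧
      (1 - (1 - α) ^ (1 / ((d : ℝ) + 1))) *
          ((Finset.univ.filter fun v => color v = i).card : ℝ) - 1
        ≤ (A.card : ℝ) - 1 := by
  classical
  obtain ⟨F₀, hF₀, hKF₀⟩ := hrep
  obtain ⟨F, hF, hF_closed, hFF₀⟩ := exists_isClosed_convex_same_nerve F₀ hF₀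
  have hKF : ∀ A : Finset V, A ∈ K ↔ (⋂ v ∈ A, F v).Nonempty := fun A =>
    (hKF₀ A).trans (hFF₀ A)
  by_contra! hcon
  set N : Fin (d + 1) → Finset V := fun i => Finset.univ.filter fun v => color v = i with hN
  set β : ℝ := (1 - α) ^ (1 / ((d : ℝ) + 1)) with hβ
  have hβ0 : 0 ≤ β := Real.rpow_nonneg (by linarith) _
  have hβ_pow : β ^ (d + 1) = 1 - α := by
    rw [hβ, one_div, ← Nat.cast_add_one, Real.rpow_inv_natCast_pow (by linarith) (by omega)]
  let r : Fin (d + 1) → ℕ := fun i => (K.filter fun A => A ⊆ N i).sup Finset.card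
  have hempty : ∅ ∈ K := (hKF ∅).2 (by simp)
  have hr_lt : ∀ i, (r i : ℝ) < (1 - β) * (N i).card := by
    intro i
    obtain ⟨A, hA, hAr⟩ := Finset.exists_mem_eq_sup (K.filter fun A => A ⊆ N i)
      ⟨∅, Finset.mem_filter.2 ⟨hempty, Finset.empty_subset _⟩⟩ Finset.card
    obtain ⟨hAK, hAN⟩ := Finset.mem_filter.1 hA
    have := hcon i A hAK fun v hv => (Finset.mem_filter.1 (hAN hv)).2
    simp only [r, hAr]
    linarith
  let R : Finset (Fin (d + 1) → V) :=
    (Fintype.piFinset N).filter fun f => Finset.univ.image f ∈ K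
  have hbound : ∏ i, ((N i).card - r i) ≤ (Fintype.piFinset N \ R).card := by
    refine prod_card_sub_le_card_transversals_not_nonempty (by simp) F hF hF_closed N r
      (fun i A hA hne => Finset.le_sup (f := Finset.card)
        (Finset.mem_filter.2 ⟨(hKF A).2 hne, hA⟩)) R fun f => ?_
    simp [R, hKF]
  have hfaces : (K.filter fun A => ∀ i, (A.filter fun v => color v = i).card = 1).card
      ≤ R.card := by
    refine Finset.card_le_card_of_surjOn (fun f => Finset.univ.image f) fun A hA => ?_
    obtain ⟨hAK, hA1⟩ := Finset.mem_filter.1 hA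
    choose f hf using fun i => Finset.card_eq_one.1 (hA1 i)
    have hmem : ∀ i, f i ∈ A ∧ color (f i) = i := fun i =>
      Finset.mem_filter.1 (by rw [hf i]; exact Finset.mem_singleton_self _)
    have himage : Finset.univ.image f = A := by
      ext v
      simp only [Finset.mem_image, Finset.mem_univ, true_and]
      refine ⟨by rintro ⟨i, rfl⟩; exact (hmem i).1, fun hv => ⟨color v, ?_⟩⟩
      have : v ∈ A.filter fun w => color w = color v := Finset.mem_filter.2 ⟨hv, rfl⟩
      rw [hf] at this
      exact (Finset.mem_singleton.1 this).symm
    refine ⟨f, Finset.mem_filter.2 ⟨Fintype.mem_piFinset.2 fun i => ?_, ?_⟩, himage⟩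
    · simpa [hN] using (hmem i).2
    · rwa [himage]
  have htotal : (Fintype.piFinset N \ R).card + R.card = ∏ i, (N i).card := by
    rw [Finset.card_sdiff_add_card_eq_card (Finset.filter_subset _ _), Fintype.card_piFinset]
  have hlt : ∀ i, β * (N i).card < (((N i).card - r i : ℕ) : ℝ) := by
    intro i
    have hle : r i ≤ (N i).card := by
      have : (r i : ℝ) ≤ (N i).card := by nlinarith [hr_lt i, (N i).card.cast_nonneg (α := ℝ)]
      exact_mod_cast this
    rw [Nat.cast_sub hle]
    linarith [hr_lt i]
  have hprod : ∏ i, (β * ((N i).card : ℝ)) < ∏ i, (((N i).card - r i : ℕ) : ℝ) := by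
    rcases hβ0.eq_or_lt with h0 | hpos
    · rw [Finset.prod_eq_zero (Finset.mem_univ 0) (by rw [← h0, zero_mul])]
      exact Finset.prod_pos fun i _ => (by positivity : 0 ≤ β * ((N i).card : ℝ)).trans_lt (hlt i)
    · exact Finset.prod_lt_prod_of_nonempty
        (fun i _ => mul_pos hpos (by exact_mod_cast hne i)) (fun i _ => hlt i)
        Finset.univ_nonempty
  rw [Finset.prod_mul_distrib, Finset.prod_const, Finset.card_univ, Fintype.card_fin,
    hβ_pow] at hprod
  have hbound' : ∏ i, (((N i).card - r i : ℕ) : ℝ) ≤ (Fintype.piFinset N \ R).card := by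
    exact_mod_cast hbound
  have htotal' : ((Fintype.piFinset N \ R).card : ℝ) + R.card = ∏ i, ((N i).card : ℝ) := by
    exact_mod_cast htotal
  have hfaces' := hcount.trans (Nat.cast_le.2 hfaces)
  linarith
end

section
/- (Kim's conjecture for convex sets, Conjecture 1.8, verified in the paper.) Let d ≥ 1, let n_i be positive and r_i non-negative integers for i ∈ {1,…,d+1} with n_i ≥ r_i + 1. Let F_1, …, F_{d+1} be families of convex sets in ℝ^d with |F_i| = n_i such that no subfamily of F_i of size r_i + 1 has a nonempty common intersection, for every i ∈ {1,…,d+1}. Then the number of colorful (d+1)-tuples with nonempty intersection is at most n_1⋯n_{d+1} − (n_1 − r_1)⋯(n_{d+1} − r_{d+1}). -/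
open scoped BigOperators

section ColorfulCounting

open Polynomial

variable {ι : Type*} [Fintype ι] [DecidableEq ι]

/-- The number of points of a box `∏ i, Fin (n i)` having some coordinate `c` below `r c`. -/
lemma card_filter_exists_lt (n r : ι → ℕ) :
    (Finset.univ.filter fun m : ∀ i, Fin (n i) => ∃ c, (m c : ℕ) < r c).card =
      ∏ i, n i - ∏ i, (n i - r i) := by
  have hcompl : (Finset.univ.filter fun m : ∀ i, Fin (n i) => ¬ ∃ c, (m c : ℕ) < r c) =
      Fintype.piFinset fun i => Finset.univ.filter fun k : Fin (n i) => ¬ (k : ℕ) < r i := by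
    ext m
    simp
  have hcard (i : ι) :
      (Finset.univ.filter fun k : Fin (n i) => ¬ (k : ℕ) < r i).card = n i - r i := by
    have h := Finset.card_filter_add_card_filter_not (s := (Finset.univ : Finset (Fin (n i))))
      (fun k => (k : ℕ) < r i)
    rw [Fin.card_filter_val_lt, Finset.card_univ, Fintype.card_fin] at h
    omega
  have h := Finset.card_filter_add_card_filter_not
    (s := (Finset.univ : Finset (∀ i, Fin (n i)))) (fun m => ∃ c, (m c : ℕ) < r c)
  rw [hcompl, Fintype.card_piFinset, Finset.card_univ, Fintype.card_pi] at h
  simp only [hcard, Fintype.card_fin] at h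
  omega

/-- A product of univariate polynomials of degrees below `n i`, one of which has degree below `r c`,
is a combination of the monomials having some exponent `c` below `r c`. -/
lemma prod_eval_mem_span (n r : ι → ℕ) (q : ι → ℝ[X]) (hq : ∀ i, (q i).natDegree < n i)
    (c : ι) (hc : (q c).natDegree < r c) :
    (fun t : ∀ i, Fin (n i) => ∏ i, (q i).eval (t i : ℝ)) ∈
      Submodule.span ℝ (((Finset.univ.filter fun m : ∀ i, Fin (n i) => ∃ c, (m c : ℕ) < r c).image
        fun m (t : ∀ i, Fin (n i)) => ∏ i, (t i : ℝ) ^ (m i : ℕ) : Finset _) :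
          Set ((∀ i, Fin (n i)) → ℝ)) := by
  have hexp : (fun t : ∀ i, Fin (n i) => ∏ i, (q i).eval (t i : ℝ)) =
      ∑ m : ∀ i, Fin (n i), (∏ i, (q i).coeff (m i)) •
        fun t : ∀ i, Fin (n i) => ∏ i, (t i : ℝ) ^ (m i : ℕ) := by
    ext t
    simp only [Finset.sum_apply, Pi.smul_apply, smul_eq_mul, ← Finset.prod_mul_distrib]
    rw [← Fintype.prod_sum fun i (k : Fin (n i)) => (q i).coeff k * (t i : ℝ) ^ (k : ℕ)]
    refine Finset.prod_congr rfl fun i _ => ?_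
    rw [eval_eq_sum_range' (hq i), Finset.sum_range]
  rw [hexp]
  refine Submodule.sum_mem _ fun m _ => ?_
  by_cases hm : (m c : ℕ) < r c
  · refine Submodule.smul_mem _ _ (Submodule.subset_span ?_)
    exact Finset.mem_coe.2 (Finset.mem_image_of_mem _
      (Finset.mem_filter.2 ⟨Finset.mem_univ _, c, hm⟩))
  · rw [Finset.prod_eq_zero (Finset.mem_univ c) (coeff_eq_zero_of_natDegree_lt (by omega)),
      zero_smul]
    exact Submodule.zero_mem _

/-- Functions on a finite set that are unitriangular with respect to a ranking are linearly
independent. -/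
lemma linearIndependent_of_triangular {α : Type*} (T : Finset α) (ρ : α → ℝ) (u : α → α → ℝ)
    (hdiag : ∀ s ∈ T, u s s = 1)
    (htri : ∀ s ∈ T, ∀ t ∈ T, u s t ≠ 0 → t ≠ s → ρ s < ρ t) :
    LinearIndependent ℝ fun s : T => u s := by
  classical
  rw [Fintype.linearIndependent_iff]
  intro g hg
  by_contra! hne
  obtain ⟨s₀, hs₀⟩ := hne
  obtain ⟨s, hs, hmin⟩ := Finset.exists_min_image (Finset.univ.filter fun s : T => g s ≠ 0)
    (fun s => ρ s) ⟨s₀, by simpa using hs₀⟩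
  have hsum := congrFun hg (s : α)
  simp only [Finset.sum_apply, Pi.smul_apply, smul_eq_mul, Pi.zero_apply] at hsum
  rw [Finset.sum_eq_single s, hdiag s s.2, mul_one] at hsum
  · exact (Finset.mem_filter.1 hs).2 hsum
  · intro t _ hts
    by_contra h
    obtain ⟨hgt, hut⟩ := mul_ne_zero_iff.1 h
    have h1 := htri t t.2 s s.2 hut fun h => hts (Subtype.ext h.symm)
    have h2 := hmin t (by simpa using hgt)
    exact absurd h1 (not_lt.2 h2)
  · simp

/-- If every element `s` of a set `T` of colorful tuples has a coordinate `c` along which at most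
`r c` elements of `T` have rank at most that of `s`, then `T` misses at least `∏ i, (n i - r i)`
tuples. -/
theorem card_le_of_ranking (n r : ι → ℕ) (T : Finset (∀ i, Fin (n i))) (ρ : (∀ i, Fin (n i)) → ℝ)
    (h : ∀ s ∈ T, ∃ c, ∃ Y : Finset (Fin (n c)), s c ∈ Y ∧ Y.card ≤ r c ∧
      ∀ y, Function.update s c y ∈ T → ρ (Function.update s c y) ≤ ρ s → y ∈ Y) :
    T.card ≤ ∏ i, n i - ∏ i, (n i - r i) := by
  let W : Finset ((∀ i, Fin (n i)) → ℝ) :=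
    (Finset.univ.filter fun m : ∀ i, Fin (n i) => ∃ c, (m c : ℕ) < r c).image
      fun m (t : ∀ i, Fin (n i)) => ∏ i, (t i : ℝ) ^ (m i : ℕ)
  have hpoly : ∀ s ∈ T, ∃ u : (∀ i, Fin (n i)) → ℝ,
      u ∈ Submodule.span ℝ (W : Set ((∀ i, Fin (n i)) → ℝ)) ∧ u s = 1 ∧
        ∀ t ∈ T, u t ≠ 0 → t ≠ s → ρ s < ρ t := by
    intro s hs
    obtain ⟨c, Y, hsY, hYr, hY⟩ := h s hs
    let Z : ∀ i, Finset (Fin (n i)) := Function.update (fun _ => Finset.univ) c Y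
    have hZc : Z c = Y := Function.update_self ..
    have hZ (i) (hi : i ≠ c) : Z i = Finset.univ := Function.update_of_ne hi ..
    have hsZ (i) : s i ∈ Z i := by
      by_cases hi : i = c
      · subst hi
        rwa [hZc]
      · simp [hZ i hi]
    have hinj (i) : Set.InjOn (fun j : Fin (n i) => (j : ℝ)) (Z i) := by
      intro a _ b _ hab
      exact Fin.ext (Nat.cast_injective hab)
    let q : ι → ℝ[X] := fun i => Lagrange.basis (Z i) (fun j : Fin (n i) => (j : ℝ)) (s i)
    have hdeg (i) : (q i).natDegree < (Z i).card := by
      have h1 : (q i).natDegree = (Z i).card - 1 :=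
        natDegree_eq_of_degree_eq_some (Lagrange.degree_basis (hinj i) (hsZ i))
      have h2 := Finset.card_pos.2 ⟨_, hsZ i⟩
      omega
    have hzero (i) (k : Fin (n i)) (hk : k ∈ Z i) (hne : (q i).eval (k : ℝ) ≠ 0) : k = s i := by
      by_contra hks
      exact hne (Lagrange.eval_basis_of_ne (v := fun j : Fin (n i) => (j : ℝ)) (Ne.symm hks) hk)
    refine ⟨fun t => ∏ i, (q i).eval (t i : ℝ), prod_eval_mem_span n r q (fun i => ?_) c ?_, ?_, ?_⟩
    · exact (hdeg i).trans_le ((Finset.card_le_univ _).trans_eq (Fintype.card_fin _))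
    · exact (hdeg c).trans_le (hZc ▸ hYr)
    · exact Finset.prod_eq_one fun i _ =>
        Lagrange.eval_basis_self (v := fun j : Fin (n i) => (j : ℝ)) (hinj i) (hsZ i)
    · intro t ht hut hts
      have hne (i) : (q i).eval (t i : ℝ) ≠ 0 := Finset.prod_ne_zero_iff.1 hut i (Finset.mem_univ i)
      have htu : Function.update s c (t c) = t := by
        rw [Function.update_eq_iff]
        exact ⟨rfl, fun i hi => (hzero i (t i) (by simp [hZ i hi]) (hne i)).symm⟩
      by_contra! hle
      have htY : t c ∈ Z c := by
        rw [hZc]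
        exact hY _ (by rwa [htu]) (by rwa [htu])
      apply hts
      rw [← htu, hzero c _ htY (hne c), Function.update_eq_self]
  choose! u hspan hdiag htri using hpoly
  have hind := linearIndependent_of_triangular T ρ u hdiag htri
  have hle := linearIndependent_le_span_aux' _ hind (W : Set _) (by
    rintro _ ⟨s, rfl⟩
    exact hspan s s.2)
  simp only [Finset.coe_sort_coe, Fintype.card_coe] at hle
  rw [← card_filter_exists_lt]
  exact hle.trans Finset.card_image_le

end ColorfulCounting

/-- If `p` is a point of smallest norm in the intersection of more than `dim E` convex sets, then
one of the sets may be dropped without creating points of smaller norm. -/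
lemma exists_norm_le_of_forall_ne_mem {ι E : Type*} [Fintype ι] [NormedAddCommGroup E]
    [NormedSpace ℝ E] [FiniteDimensional ℝ E] (hcard : Module.finrank ℝ E < Fintype.card ι)
    {C : ι → Set E} (hC : ∀ i, Convex ℝ (C i)) {p : E} (hp : ∀ i, p ∈ C i)
    (hmin : ∀ x, (∀ i, x ∈ C i) → ‖p‖ ≤ ‖x‖) :
    ∃ c, ∀ x, (∀ i, i ≠ c → x ∈ C i) → ‖p‖ ≤ ‖x‖ := by
  classical
  by_contra! hcon
  choose x hxC hxp using hcon
  let G : Option ι → Set E := fun o => o.elim (Metric.ball 0 ‖p‖) C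
  have hG : (⋂ o ∈ (Finset.univ : Finset (Option ι)), G o).Nonempty := by
    refine Convex.helly_theorem' (𝕜 := ℝ) ?_ ?_
    · rintro (_ | i) _
      · exact convex_ball 0 ‖p‖
      · exact hC i
    · intro I _ hI
      obtain ⟨o, ho⟩ : ∃ o, o ∉ I := by
        by_contra! hall
        have := Finset.card_le_card fun o (_ : o ∈ Finset.univ) => hall o
        rw [Finset.card_univ, Fintype.card_option] at this
        omega
      cases o with
      | none =>
        refine ⟨p, Set.mem_iInter₂.2 ?_⟩
        rintro (_ | i) hi
        · exact absurd hi ho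
        · exact hp i
      | some c =>
        refine ⟨x c, Set.mem_iInter₂.2 ?_⟩
        rintro (_ | i) hi
        · exact mem_ball_zero_iff.2 (hxp c)
        · exact hxC c i fun hic => ho (hic ▸ hi)
  obtain ⟨y, hy⟩ := hG
  simp only [Set.mem_iInter, Finset.mem_univ, true_imp_iff] at hy
  exact absurd (hmin y fun i => hy (some i)) (not_le.2 (mem_ball_zero_iff.1 (hy none)))

/-- Points of smallest norm in a convex subset of a strictly convex space are unique. -/
lemma Convex.eq_of_norm_le {E : Type*} [NormedAddCommGroup E] [NormedSpace ℝ E]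
    [StrictConvexSpace ℝ E] {K : Set E} (hK : Convex ℝ K) {p x : E} (hp : p ∈ K) (hx : x ∈ K)
    (hmin : ∀ y ∈ K, ‖p‖ ≤ ‖y‖) (hxp : ‖x‖ ≤ ‖p‖) : x = p := by
  by_contra hne
  have hlt := norm_combo_lt_of_ne hxp le_rfl hne (half_pos one_pos) (half_pos one_pos)
    (add_halves (1 : ℝ))
  exact absurd (hmin _ (hK hx hp (half_pos one_pos).le (half_pos one_pos).le (add_halves 1)))
    (not_le.2 hlt)

/-- Kim's bound for compact convex sets. -/
theorem colorful_card_le_of_isCompact {ι E : Type*} [Fintype ι] [NormedAddCommGroup E]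
    [NormedSpace ℝ E] [StrictConvexSpace ℝ E] [FiniteDimensional ℝ E]
    (hcard : Module.finrank ℝ E < Fintype.card ι) (n r : ι → ℕ) (G : ∀ i, Fin (n i) → Set E)
    (hconv : ∀ i j, Convex ℝ (G i j)) (hcomp : ∀ i j, IsCompact (G i j))
    (hdepth : ∀ i (Y : Finset (Fin (n i))) (p : E), (∀ j ∈ Y, p ∈ G i j) → Y.card ≤ r i)
    (T : Finset (∀ i, Fin (n i))) (hT : ∀ t ∈ T, (⋂ i, G i (t i)).Nonempty) :
    T.card ≤ ∏ i, n i - ∏ i, (n i - r i) := by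
  classical
  have hmin : ∀ t ∈ T, ∃ p, (∀ i, p ∈ G i (t i)) ∧ ∀ x, (∀ i, x ∈ G i (t i)) → ‖p‖ ≤ ‖x‖ := by
    intro t ht
    have : Nonempty ι := Fintype.card_pos_iff.1 (by omega)
    have hc : IsCompact (⋂ i, G i (t i)) :=
      (hcomp _ _).of_isClosed_subset (isClosed_iInter fun i => (hcomp i (t i)).isClosed)
        (Set.iInter_subset _ (Classical.arbitrary ι))
    obtain ⟨p, hp, hpmin⟩ := hc.exists_isMinOn (hT t ht) continuous_norm.continuousOn
    exact ⟨p, Set.mem_iInter.1 hp, fun x hx => hpmin (Set.mem_iInter.2 hx)⟩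
  choose! p hp hpmin using hmin
  refine card_le_of_ranking n r T (fun t => ‖p t‖) fun s hs => ?_
  obtain ⟨c, hc⟩ := exists_norm_le_of_forall_ne_mem hcard (fun i => hconv i (s i)) (hp s hs)
    (hpmin s hs)
  refine ⟨c, Finset.univ.filter fun y => p s ∈ G c y, by simpa using hp s hs c,
    hdepth c _ (p s) fun j hj => (Finset.mem_filter.1 hj).2, fun y hyT hy => ?_⟩
  have hmem := hp _ hyT
  have heq : p (Function.update s c y) = p s := by
    refine Convex.eq_of_norm_le (K := ⋂ i, ⋂ (_ : i ≠ c), G i (s i))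
      (convex_iInter₂ fun i _ => hconv i (s i)) (Set.mem_iInter₂.2 fun i _ => hp s hs i)
      (Set.mem_iInter₂.2 fun i hi => ?_) (fun x hx => hc x (Set.mem_iInter₂.1 hx)) hy
    have := hmem i
    rwa [Function.update_of_ne hi] at this
  have := hmem c
  rw [Function.update_self, heq] at this
  exact Finset.mem_filter.2 ⟨Finset.mem_univ _, this⟩

/-- **Kim's conjecture for convex sets (Conjecture 1.8, verified in the paper)**.
Families with repetitions are modeled as indexed families
`F i : Fin (n i) → Set (EuclideanSpace ℝ (Fin d))` of convex sets. If no subfamily of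
`F i` of size `r i + 1` has a nonempty common intersection, then the number of colorful
`(d+1)`-tuples with nonempty intersection is at most
`n 1 ⋯ n (d+1) - (n 1 - r 1) ⋯ (n (d+1) - r (d+1))`. -/
theorem kim_conjecture_convex
    (d : ℕ) (hd : 1 ≤ d) (n r : Fin (d + 1) → ℕ) (hnr : ∀ i, r i + 1 ≤ n i)
    (F : ∀ i : Fin (d + 1), Fin (n i) → Set (EuclideanSpace ℝ (Fin d)))
    (hconv : ∀ i j, Convex ℝ (F i j))
    (hdim : ∀ i, ∀ s : Finset (Fin (n i)), s.card = r i + 1 → ¬ (⋂ j ∈ s, F i j).Nonempty) :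
    Set.ncard {t : ∀ i : Fin (d + 1), Fin (n i) | (⋂ i, F i (t i)).Nonempty} ≤
      ∏ i, n i - ∏ i, (n i - r i) := by
  classical
  rw [Set.ncard_eq_toFinset_card']
  set T := Set.toFinset {t : ∀ i : Fin (d + 1), Fin (n i) | (⋂ i, F i (t i)).Nonempty} with hTdef
  have hT : ∀ t ∈ T, ∃ x, x ∈ ⋂ i, F i (t i) := fun t ht => by
    rw [hTdef, Set.mem_toFinset] at ht
    exact ht
  choose! x hx using hT
  let G : ∀ i : Fin (d + 1), Fin (n i) → Set (EuclideanSpace ℝ (Fin d)) :=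
    fun i j => convexHull ℝ (x '' {t | t ∈ T ∧ t i = j})
  have hGF (i j) : G i j ⊆ F i j := by
    refine convexHull_min ?_ (hconv i j)
    rintro _ ⟨t, ⟨ht, rfl⟩, rfl⟩
    exact Set.mem_iInter.1 (hx t ht) i
  refine colorful_card_le_of_isCompact (by simp) n r G (fun i j => convex_convexHull ℝ _)
    (fun i j => ((Set.toFinite _).image x).isCompact_convexHull ℝ) ?_ T fun t ht =>
      ⟨x t, Set.mem_iInter.2 fun i => subset_convexHull ℝ _ ⟨t, ⟨ht, rfl⟩, rfl⟩⟩
  intro i Y p hY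
  by_contra! hlt
  obtain ⟨s, hsY, hs⟩ := Finset.exists_subset_card_eq (Nat.succ_le_of_lt hlt)
  exact hdim i s hs ⟨p, Set.mem_iInter₂.2 fun j hj => hGF i j (hY j (hsY hj))⟩
end

section
/- (Proposition 3.3, strict version of the k-colorful fractional Helly theorem.) Let c, d ≥ 1 and let k = (k_1, …, k_c) be a vector of non-negative integers. Let K be a d-collapsible simplicial complex with vertex partition N = N_1 ⊔ ⋯ ⊔ N_c, n_i := |N_i| ≥ 1, and let β = (β_1, …, β_c) ∈ (0,1]^c. If K contains strictly more than α_k(d,β) · |binom(N,k)| k-colorful faces, then there exists i ∈ {1,…,c} such that dim K[N_i] > β_i·n_i − 1. -/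
open scoped BigOperators

/-- `K'` arises from `K` by an elementary `d`-collapse: there are faces `L, M ∈ K`
with `|L| ≤ d` (i.e. `dim L ≤ d - 1`) such that `M` is the unique inclusion-wise
maximal face of `K` containing `L` (equivalently, every face containing `L` is
contained in `M`), and `K'` is obtained from `K` by removing all faces containing `L`. -/
def ElemCollapse {V : Type*} [DecidableEq V] (d : ℕ) (K K' : Finset (Finset V)) : Prop :=
  ∃ L M, L ∈ K ∧ M ∈ K ∧ L.card ≤ d ∧ (∀ A ∈ K, L ⊆ A → A ⊆ M) ∧
    K' = K.filter fun A => ¬ L ⊆ A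

/-- `K` is `d`-collapsible: there is a sequence of elementary `d`-collapses from `K`
to the empty complex. -/
def Collapsible {V : Type*} [DecidableEq V] (d : ℕ) (K : Finset (Finset V)) : Prop :=
  Relation.ReflTransGen (ElemCollapse d) K ∅

/-- The quantity `α_k(d, β) = Σ_{ℓ ∈ L_k(d)} Π_i C(k i, ℓ i) (1 - β i)^(ℓ i) (β i)^(k i - ℓ i)`,
where `L_k(d)` is the set of vectors `ℓ` with `ℓ i ≤ k i` for all `i` and `Σ ℓ i ≤ d`
(encoded by letting `ℓ i` range over `Fin (k i + 1)`). -/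
noncomputable def alphaK (c d : ℕ) (k : Fin c → ℕ) (β : Fin c → ℝ) : ℝ :=
  ∑ ℓ ∈ Finset.univ.filter (fun ℓ : ∀ i : Fin c, Fin (k i + 1) => (∑ i, (ℓ i : ℕ)) ≤ d),
    ∏ i, (Nat.choose (k i) (ℓ i) : ℝ) * (1 - β i) ^ ((ℓ i : ℕ)) * (β i) ^ (k i - (ℓ i : ℕ))

section

open Finset

lemma Collapsible.exists_rank {V : Type*} [DecidableEq V] {d : ℕ} {K : Finset (Finset V)}
    (h : Collapsible d K) :
    ∃ (rank : Finset V → ℕ) (L M : Finset V → Finset V), ∀ A ∈ K,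
      L A ⊆ A ∧ A ⊆ M A ∧ M A ∈ K ∧ (L A).card ≤ d ∧
      ∀ B ∈ K, L A ⊆ B → rank B < rank A ∨ (rank B = rank A ∧ B ⊆ M A) := by
  unfold Collapsible at h
  induction h using Relation.ReflTransGen.head_induction_on with
  | refl => exact ⟨fun _ => 0, id, id, by simp⟩
  | head hstep _ ih =>
    rename_i K K' _
    obtain ⟨rank, L, M, ih⟩ := ih
    obtain ⟨L₀, M₀, hL, hM, hc, hmax, rfl⟩ := hstep
    refine ⟨fun A => if L₀ ⊆ A then 0 else rank A + 1, fun A => if L₀ ⊆ A then L₀ else L A,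
      fun A => if L₀ ⊆ A then M₀ else M A, fun A hA => ?_⟩
    by_cases h : L₀ ⊆ A
    · simp only [h, if_true]
      refine ⟨trivial, hmax A hA h, hM, hc, fun B hB hLB => ?_⟩
      simp [hLB, hmax B hB hLB]
    · obtain ⟨h1, h2, h3, h4, h5⟩ := ih A (by simp [hA, h])
      simp only [h, if_false]
      refine ⟨h1, h2, (mem_filter.1 h3).1, h4, fun B hB hLB => ?_⟩
      by_cases hB' : L₀ ⊆ B
      · simp [hB']
      · simp only [hB', if_false]
        have := h5 B (by simp [hB, hB']) hLB
        simpa using this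

lemma card_le_card_of_triangular {X : Type*} [DecidableEq X] (Z : Finset X) (rank : X → ℕ)
    (g : X → X → ℚ) (W : Finset (X → ℚ))
    (hspan : ∀ x ∈ Z, g x ∈ Submodule.span ℚ (W : Set (X → ℚ)))
    (hdiag : ∀ x ∈ Z, g x x ≠ 0)
    (htri : ∀ x ∈ Z, ∀ y ∈ Z, g x y ≠ 0 → rank y < rank x ∨ y = x) :
    Z.card ≤ W.card := by
  have hli : LinearIndependent ℚ (fun x : Z => g x) := by
    rw [Fintype.linearIndependent_iff]
    intro a ha
    by_contra! hne
    obtain ⟨x₁, hx₁⟩ := hne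
    obtain ⟨x₀, hx₀, hmax⟩ := exists_max_image (univ.filter fun x : Z => a x ≠ 0)
      (fun x => rank x) ⟨x₁, by simpa using hx₁⟩
    have h0 := congrFun ha x₀
    rw [Finset.sum_apply, Finset.sum_eq_single x₀] at h0
    · simp only [Pi.smul_apply, smul_eq_mul, Pi.zero_apply, mul_eq_zero] at h0
      exact h0.elim (mem_filter.1 hx₀).2 (hdiag x₀ x₀.2)
    · intro x _ hx
      by_contra hx'
      simp only [Pi.smul_apply, smul_eq_mul, mul_eq_zero, not_or] at hx'
      rcases htri x x.2 x₀ x₀.2 hx'.2 with h | h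
      · have := hmax x (by simpa using hx'.1)
        omega
      · exact hx (Subtype.ext h.symm)
    · simp
  have := finrank_span_eq_card hli
  rw [Fintype.card_coe] at this
  rw [← this]
  refine (Submodule.finrank_mono (t := Submodule.span ℚ (W : Set (X → ℚ))) ?_).trans
    (finrank_span_finset_le_card W)
  rw [Submodule.span_le]
  rintro _ ⟨x, rfl⟩
  exact hspan x x.2

lemma prod_eval_mem_span_s9 {P V : Type*} [Fintype P] [DecidableEq P]
    (τ : V → ℚ) (Q : P → Polynomial ℚ) (D : P → ℕ) (hD : ∀ p, (Q p).natDegree < D p)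
    (W : Set ((P → V) → ℚ))
    (hW : ∀ t : P → ℕ, (∀ p, t p < D p) → (fun y => ∏ p, τ (y p) ^ t p) ∈ W) :
    (fun y : P → V => ∏ p, (Q p).eval (τ (y p))) ∈ Submodule.span ℚ W := by
  have : (fun y : P → V => ∏ p, (Q p).eval (τ (y p))) =
      ∑ t ∈ Fintype.piFinset (fun p => range (D p)),
        (∏ p, (Q p).coeff (t p)) • (fun y : P → V => ∏ p, τ (y p) ^ t p) := by
    ext y
    simp only [fun p => Polynomial.eval_eq_sum_range' (hD p) (τ (y p)), prod_univ_sum,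
      Finset.sum_apply, Pi.smul_apply, smul_eq_mul, prod_mul_distrib]
  rw [this]
  exact Submodule.sum_mem _ fun t ht => Submodule.smul_mem _ _ <| Submodule.subset_span <|
    hW t (by simpa using ht)

lemma exists_card_le_subset_image {P V : Type*} [DecidableEq P] [Fintype P] [DecidableEq V]
    {x : P → V} {L : Finset V} (h : L ⊆ univ.image x) :
    ∃ A : Finset P, A.card ≤ L.card ∧ L ⊆ A.image x := by
  have : ∀ v : L, ∃ p, x p = v := fun v => by simpa using h v.2
  choose f hf using this
  refine ⟨univ.image f, card_image_le.trans (by simp), fun v hv => ?_⟩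
  simp only [mem_image, mem_univ, true_and]
  exact ⟨f ⟨v, hv⟩, ⟨_, rfl⟩, hf _⟩

lemma card_sequences_le {V P ι : Type*} [Fintype V] [DecidableEq V] [Fintype P] [DecidableEq P]
    [DecidableEq ι] {d : ℕ} {K : Finset (Finset V)} (hK : IsComplex K) (hcoll : Collapsible d K)
    (color : V → ι) (κ : P → ι) (r : ι → ℕ)
    (hr : ∀ i, ∀ A ∈ K, (∀ v ∈ A, color v = i) → A.card ≤ r i)
    (hrn : ∀ i, r i ≤ (univ.filter fun v => color v = i).card) :
    ((Fintype.piFinset fun p => univ.filter fun v => color v = κ p).filter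
        fun x => univ.image x ∈ K).card ≤
      ((Fintype.piFinset fun p => range (univ.filter fun v => color v = κ p).card).filter
        fun t => (univ.filter fun p => r (κ p) ≤ t p).card ≤ d).card := by
  obtain ⟨rank, L, M, h⟩ := hcoll.exists_rank
  obtain ⟨τ, hτ⟩ : ∃ τ : V → ℚ, Function.Injective τ :=
    ⟨fun v => (Fintype.equivFin V v : ℕ), fun a b hab => by
      simpa [Fin.val_inj] using hab⟩
  have hA : ∀ x : P → V, ∃ A : Finset P, univ.image x ∈ K →
      A.card ≤ d ∧ L (univ.image x) ⊆ A.image x := fun x => by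
    by_cases hx : univ.image x ∈ K
    · obtain ⟨A, h1, h2⟩ := exists_card_le_subset_image (h _ hx).1
      exact ⟨A, fun _ => ⟨h1.trans (h _ hx).2.2.2.1, h2⟩⟩
    · exact ⟨∅, fun h => absurd h hx⟩
  choose A hA using hA
  let nodes : (P → V) → P → Finset V := fun x p =>
    if p ∈ A x then univ.filter fun v => color v = κ p
    else (M (univ.image x)).filter fun v => color v = κ p
  let g : (P → V) → (P → V) → ℚ := fun x y =>
    ∏ p, (Lagrange.basis (nodes x p) τ (x p)).eval (τ (y p))
  set T := (Fintype.piFinset fun p => range (univ.filter fun v => color v = κ p).card).filter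
        fun t => (univ.filter fun p => r (κ p) ≤ t p).card ≤ d
  refine (card_le_card_of_triangular _ (fun x => rank (univ.image x)) g
    (T.image fun t y => ∏ p, τ (y p) ^ t p) ?_ ?_ ?_).trans card_image_le
  · intro x hx
    simp only [mem_filter, Fintype.mem_piFinset, mem_univ, true_and] at hx
    obtain ⟨hxc, hxK⟩ := hx
    have hxn : ∀ p, x p ∈ nodes x p := fun p => by
      by_cases hp : p ∈ A x
      · simp [nodes, hp, hxc]
      · simp only [nodes, hp, if_false, mem_filter, hxc, and_true]
        exact (h _ hxK).2.1 (mem_image_of_mem _ (mem_univ p))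
    refine prod_eval_mem_span_s9 τ _ (fun p => (nodes x p).card) (fun p => ?_) _ (fun t ht => ?_)
    · rw [Polynomial.natDegree_eq_of_degree_eq_some (Lagrange.degree_basis hτ.injOn (hxn p))]
      have : 0 < (nodes x p).card := card_pos.2 ⟨_, hxn p⟩
      omega
    · have hM : ∀ p ∉ A x, t p < r (κ p) := fun p hp => by
        refine (ht p).trans_le ?_
        simp only [nodes, hp, if_false]
        exact hr _ _ (hK _ (h _ hxK).2.2.1 _ (filter_subset _ _)) (by simp)
      simp only [coe_image, Set.mem_image, mem_coe]
      refine ⟨t, ?_, rfl⟩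
      simp only [T, mem_filter, Fintype.mem_piFinset, mem_range]
      refine ⟨fun p => ?_, (card_le_card fun p hp => ?_).trans (hA x hxK).1⟩
      · by_cases hp : p ∈ A x
        · simpa [nodes, hp] using ht p
        · exact (hM p hp).trans_le (hrn _)
      · by_contra hpA
        have := hM p hpA
        simp only [mem_filter, mem_univ, true_and] at hp
        omega
  · intro x hx
    simp only [mem_filter, Fintype.mem_piFinset, mem_univ, true_and] at hx
    obtain ⟨hxc, hxK⟩ := hx
    refine prod_ne_zero_iff.2 fun p _ => ?_
    rw [Lagrange.eval_basis_self hτ.injOn]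
    · exact one_ne_zero
    · by_cases hp : p ∈ A x
      · simp [nodes, hp, hxc]
      · simp only [nodes, hp, if_false, mem_filter, hxc, and_true]
        exact (h _ hxK).2.1 (mem_image_of_mem _ (mem_univ p))
  · intro x hx y hy hxy
    simp only [mem_filter, Fintype.mem_piFinset, mem_univ, true_and] at hx hy
    have key : ∀ p, y p ∈ nodes x p → y p = x p := fun p hp => by
      by_contra hne
      exact hxy (prod_eq_zero (mem_univ p) (Lagrange.eval_basis_of_ne (Ne.symm hne) hp))
    have hyA : ∀ p ∈ A x, y p = x p := fun p hp => key p (by simp [nodes, hp, hy.1])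
    have hL : L (univ.image x) ⊆ univ.image y := fun v hv => by
      obtain ⟨p, hp, rfl⟩ := mem_image.1 ((hA x hx.2).2 hv)
      exact mem_image.2 ⟨p, mem_univ p, hyA p hp⟩
    refine ((h _ hx.2).2.2.2.2 _ hy.2 hL).imp_right fun hM => funext fun p => ?_
    by_cases hp : p ∈ A x
    · exact hyA p hp
    · refine key p ?_
      simp only [nodes, hp, if_false, mem_filter, hy.1, and_true]
      exact hM.2 (mem_image_of_mem _ (mem_univ p))

/-- The expectation of `φ` evaluated at the number of failures among independent trials indexed
by `P`, the trial `p` succeeding with probability `b p`. -/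
noncomputable def failureExpectation {ι : Type*} [DecidableEq ι] (P : Finset ι) (φ : ℕ → ℝ)
    (b : ι → ℝ) : ℝ :=
  ∑ A ∈ P.powerset, (∏ p ∈ A, (1 - b p)) * (∏ p ∈ P \ A, b p) * φ A.card

lemma failureExpectation_insert {ι : Type*} [DecidableEq ι] {P : Finset ι} {q : ι} (hq : q ∉ P)
    (φ : ℕ → ℝ) (b : ι → ℝ) :
    failureExpectation (insert q P) φ b =
      b q * failureExpectation P φ b + (1 - b q) * failureExpectation P (fun m => φ (m + 1)) b := by
  unfold failureExpectation
  rw [sum_powerset_insert hq, mul_sum, mul_sum]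
  congr 1 <;> refine sum_congr rfl fun A hA => ?_
  · have hqA : q ∉ A := fun h => hq (mem_powerset.1 hA h)
    rw [insert_sdiff_of_notMem _ hqA, prod_insert (by simp [hq])]
    ring
  · have hqA : q ∉ A := fun h => hq (mem_powerset.1 hA h)
    rw [insert_sdiff_insert, sdiff_insert_of_notMem hq, prod_insert hqA, card_insert_of_notMem hqA]
    ring

lemma failureExpectation_le_of_le {ι : Type*} [DecidableEq ι] (P : Finset ι) {φ ψ : ℕ → ℝ}
    (h : ∀ m, φ m ≤ ψ m) {b : ι → ℝ} (h0 : ∀ p, 0 ≤ b p) (h1 : ∀ p, b p ≤ 1) :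
    failureExpectation P φ b ≤ failureExpectation P ψ b :=
  sum_le_sum fun _ _ => mul_le_mul_of_nonneg_left (h _) <|
    mul_nonneg (prod_nonneg fun p _ => sub_nonneg.2 (h1 p)) (prod_nonneg fun p _ => h0 p)

lemma failureExpectation_mono {ι : Type*} [DecidableEq ι] (P : Finset ι) {φ : ℕ → ℝ}
    (hφ : Antitone φ) {b b' : ι → ℝ} (h0 : ∀ p, 0 ≤ b p) (hb : ∀ p, b p ≤ b' p)
    (h1 : ∀ p, b' p ≤ 1) :
    failureExpectation P φ b ≤ failureExpectation P φ b' := by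
  induction P using Finset.induction_on generalizing φ with
  | empty => simp [failureExpectation]
  | insert q P hq ih =>
    rw [failureExpectation_insert hq, failureExpectation_insert hq]
    have e1 := ih hφ
    have e2 := ih (φ := fun m => φ (m + 1)) fun m n h => hφ (by omega)
    have e3 : failureExpectation P (fun m => φ (m + 1)) b' ≤ failureExpectation P φ b' :=
      failureExpectation_le_of_le P (fun m => hφ (by omega)) (fun p => (h0 p).trans (hb p)) h1
    nlinarith [mul_le_mul_of_nonneg_left e1 (h0 q),
      mul_le_mul_of_nonneg_left e2 (sub_nonneg.2 ((hb q).trans (h1 q))),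
      mul_le_mul_of_nonneg_left e3 (sub_nonneg.2 (hb q))]

lemma card_threshold_filter {P : Type*} [Fintype P] [DecidableEq P] (d : ℕ) (n r : P → ℕ)
    (hrn : ∀ p, r p ≤ n p) (hn : ∀ p, 1 ≤ n p) :
    (((Fintype.piFinset fun p => range (n p)).filter
        fun t => (univ.filter fun p => r p ≤ t p).card ≤ d).card : ℝ) =
      (∏ p, (n p : ℝ)) *
        failureExpectation univ (fun m => if m ≤ d then 1 else 0) fun p => (r p : ℝ) / n p := by
  have hfib : ∀ A : Finset P, ((Fintype.piFinset fun p => range (n p)).filter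
      fun t => univ.filter (fun p => r p ≤ t p) = A) =
      Fintype.piFinset fun p => if p ∈ A then Ico (r p) (n p) else range (r p) := fun A => by
    ext t
    simp only [mem_filter, Fintype.mem_piFinset, mem_range, Finset.ext_iff, mem_univ, true_and]
    rw [← forall_and]
    refine forall_congr' fun p => ?_
    have := hrn p
    by_cases hp : p ∈ A <;> simp [hp] <;> omega
  have hfibcard : ∀ A : Finset P, (((Fintype.piFinset fun p => range (n p)).filter
      fun t => univ.filter (fun p => r p ≤ t p) = A).card : ℝ) =
      (∏ p, (n p : ℝ)) * ((∏ p ∈ A, (1 - (r p : ℝ) / n p)) *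
        ∏ p ∈ univ \ A, (r p : ℝ) / n p) := fun A => by
    have e : ∀ f : P → ℝ, ∏ p, f p = (∏ p ∈ univ \ A, f p) * ∏ p ∈ A, f p := fun f =>
      (prod_sdiff (subset_univ A)).symm
    rw [hfib, Fintype.card_piFinset, Nat.cast_prod, e, e, mul_comm (∏ p ∈ A, (1 - _)),
      mul_mul_mul_comm, ← prod_mul_distrib, ← prod_mul_distrib]
    congr 1
    · refine prod_congr rfl fun p hp => ?_
      have : (n p : ℝ) ≠ 0 := by have := hn p; positivity
      simp only [mem_sdiff, mem_univ, true_and] at hp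
      simp only [hp, if_false, card_range]
      field_simp
    · refine prod_congr rfl fun p hp => ?_
      have : (n p : ℝ) ≠ 0 := by have := hn p; positivity
      simp only [hp, if_true, Nat.card_Ico, Nat.cast_sub (hrn p)]
      field_simp
  rw [failureExpectation, mul_sum, powerset_univ,
    card_eq_sum_card_fiberwise (f := fun t => univ.filter fun p => r p ≤ t p) (t := univ)
      (fun _ _ => by simp), Nat.cast_sum]
  refine sum_congr rfl fun A _ => ?_
  rw [filter_filter]
  by_cases hA : A.card ≤ d
  · simp only [hA, if_true, mul_one]
    rw [← hfibcard]
    congr 2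
    ext t
    simp only [mem_filter, and_congr_right_iff, and_iff_right_iff_imp]
    rintro _ rfl
    exact hA
  · simp only [hA, if_false, mul_zero, Nat.cast_eq_zero, card_eq_zero, filter_eq_empty_iff]
    rintro t _ ⟨h, rfl⟩
    exact hA h

lemma card_sigma_finset_with_fiber_card {ι : Type*} [Fintype ι] [DecidableEq ι] {α : ι → Type*}
    [∀ i, Fintype (α i)] [∀ i, DecidableEq (α i)] (ℓ : ι → ℕ) :
    (univ.filter fun A : Finset (Σ i, α i) => ∀ i, (A.filter fun p => p.1 = i).card = ℓ i).card =
      ∏ i, (Fintype.card (α i)).choose (ℓ i) := by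
  have hcard : ∀ (A : Finset (Σ i, α i)) (i : ι),
      (A.filter fun p => p.1 = i).card = (univ.filter fun a : α i => ⟨i, a⟩ ∈ A).card :=
    fun A i => by
      symm
      refine card_bij (fun a _ => ⟨i, a⟩) (by simp) (by simp) ?_
      rintro ⟨j, a⟩ h
      obtain ⟨h, rfl⟩ := mem_filter.1 h
      exact ⟨a, by simpa using h, rfl⟩
  have : ∏ i, (Fintype.card (α i)).choose (ℓ i) =
      (Fintype.piFinset fun i => powersetCard (ℓ i) (univ : Finset (α i))).card := by
    simp [Fintype.card_piFinset]
  rw [this]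
  refine card_bij' (fun A _ i => univ.filter fun a => ⟨i, a⟩ ∈ A) (fun f _ => univ.sigma f)
    ?_ ?_ ?_ ?_
  · intro A hA
    simp only [mem_filter, mem_univ, true_and] at hA
    simp [mem_powersetCard, ← hcard, hA]
  · intro f hf
    simp only [Fintype.mem_piFinset, mem_powersetCard, subset_univ, true_and] at hf
    simp only [mem_filter, mem_univ, true_and, hcard]
    intro i
    rw [← hf i]
    congr 1
    ext a
    simp
  · intro A _
    ext ⟨i, a⟩
    simp
  · intro f _
    ext i a
    simp

lemma card_sigma_fiber {c : ℕ} (k : Fin c → ℕ) (i : Fin c) :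
    ((univ : Finset (Σ i, Fin (k i))).filter fun p => p.1 = i).card = k i := by
  have : ((univ : Finset (Σ i, Fin (k i))).filter fun p => p.1 = i) =
      (univ : Finset (Fin (k i))).map (Function.Embedding.sigmaMk i) := by
    ext ⟨j, a⟩
    simp only [mem_filter, mem_univ, true_and, mem_map, Function.Embedding.sigmaMk_apply]
    constructor
    · rintro rfl
      exact ⟨a, rfl⟩
    · rintro ⟨b, hb⟩
      exact (congrArg Sigma.fst hb).symm
  rw [this]
  simp

lemma alphaK_eq_failureExpectation (c d : ℕ) (k : Fin c → ℕ) (β : Fin c → ℝ) :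
    alphaK c d k β = failureExpectation (univ : Finset (Σ i, Fin (k i)))
      (fun m => if m ≤ d then 1 else 0) fun p => β p.1 := by
  have hle : ∀ (A : Finset (Σ i, Fin (k i))) i, (A.filter fun p => p.1 = i).card ≤ k i :=
    fun A i => (card_le_card (filter_subset_filter _ (subset_univ A))).trans_eq (card_sigma_fiber k i)
  let cnt : Finset (Σ i, Fin (k i)) → ∀ i, Fin (k i + 1) :=
    fun A i => ⟨(A.filter fun p => p.1 = i).card, Nat.lt_succ_of_le (hle A i)⟩
  have hprod : ∀ (A : Finset (Σ i, Fin (k i))) (f : Fin c → ℝ),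
      ∏ p ∈ A, f p.1 = ∏ i, f i ^ (A.filter fun p => p.1 = i).card := fun A f => by
    rw [← prod_fiberwise_of_maps_to (t := univ) (g := fun p => p.1) (fun _ _ => mem_univ _)]
    refine prod_congr rfl fun i _ => ?_
    rw [prod_congr rfl (g := fun _ => f i), prod_const]
    intro p hp
    rw [(mem_filter.1 hp).2]
  have hsum : ∀ A : Finset (Σ i, Fin (k i)),
      A.card = ∑ i, (A.filter fun p => p.1 = i).card := fun A =>
    card_eq_sum_card_fiberwise (fun _ _ => mem_coe.2 (mem_univ _))
  have hcompl : ∀ (A : Finset (Σ i, Fin (k i))) i, ((univ \ A).filter fun p => p.1 = i).card =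
      k i - (A.filter fun p => p.1 = i).card := fun A i => by
    rw [← card_sigma_fiber k i, ← card_sdiff_of_subset (filter_subset_filter _ (subset_univ A))]
    congr 1
    ext p
    simp only [mem_filter, mem_univ, true_and, mem_sdiff]
    tauto
  have hterm : ∀ A : Finset (Σ i, Fin (k i)),
      (∏ p ∈ A, (1 - β p.1)) * (∏ p ∈ univ \ A, β p.1) *
          (if A.card ≤ d then (1 : ℝ) else 0) =
        if (∑ i, (cnt A i : ℕ)) ≤ d then
          ∏ i, (1 - β i) ^ (cnt A i : ℕ) * β i ^ (k i - (cnt A i : ℕ)) else 0 := fun A => by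
    rw [hprod A (fun i => 1 - β i), hprod (univ \ A) β, ← prod_mul_distrib]
    simp only [hcompl, hsum A, mul_ite, mul_one, mul_zero, cnt]
  rw [failureExpectation, powerset_univ, sum_congr rfl fun A _ => hterm A, alphaK, sum_filter,
    ← sum_fiberwise_of_maps_to (t := univ) (g := cnt) (fun _ _ => mem_univ _)]
  refine sum_congr rfl fun ℓ _ => ?_
  rw [sum_congr rfl (g := fun _ => if (∑ i, (ℓ i : ℕ)) ≤ d then
      ∏ i, (1 - β i) ^ (ℓ i : ℕ) * β i ^ (k i - (ℓ i : ℕ)) else 0), sum_const]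
  · have : (univ.filter fun A => cnt A = ℓ).card = ∏ i, (k i).choose (ℓ i) := by
      have := card_sigma_finset_with_fiber_card (α := fun i => Fin (k i)) (fun i => (ℓ i : ℕ))
      simp only [Fintype.card_fin] at this
      rw [← this]
      congr 1
      ext A
      simp [cnt, funext_iff, Fin.ext_iff]
    rw [this]
    split_ifs
    · simp [mul_assoc, prod_mul_distrib]
    · simp
  · intro A hA
    rw [(mem_filter.1 hA).2]

lemma exists_perm_image_eq {V ι : Type*} [Fintype V] [DecidableEq V] [DecidableEq ι]
    (color : V → ι) {S T : Finset V}
    (h : ∀ i, (S.filter fun v => color v = i).card = (T.filter fun v => color v = i).card) :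
    ∃ σ : Equiv.Perm V, (∀ v, color (σ v) = color v) ∧ S.image σ = T := by
  have hcard : ∀ z : ι × Bool, Nonempty
      ({v // (color v, decide (v ∈ S)) = z} ≃ {v // (color v, decide (v ∈ T)) = z}) := by
    rintro ⟨i, b⟩
    refine Fintype.card_eq.1 ?_
    simp only [Prod.mk.injEq, Fintype.card_subtype]
    have key : ∀ U : Finset V, (univ.filter fun v => color v = i ∧ decide (v ∈ U) = true) =
        U.filter fun v => color v = i := fun U => by ext; simp [and_comm]
    cases b
    · have key' : ∀ U : Finset V,
          (univ.filter fun v => color v = i ∧ decide (v ∈ U) = false).card =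
          (univ.filter fun v => color v = i).card - (U.filter fun v => color v = i).card :=
        fun U => by
          rw [← card_sdiff_of_subset (filter_subset_filter _ (subset_univ U))]
          congr 1
          ext v
          simp only [decide_eq_false_iff_not, mem_filter, mem_univ, true_and, mem_sdiff]
          tauto
      rw [key', key', h]
    · rw [key, key, h]
  let σ : Equiv.Perm V := Equiv.ofFiberEquiv fun z => (hcard z).some
  have hσ : ∀ v, (color (σ v), decide (σ v ∈ T)) = (color v, decide (v ∈ S)) :=
    Equiv.ofFiberEquiv_map fun z => (hcard z).some
  simp only [Prod.mk.injEq, decide_eq_decide] at hσ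
  refine ⟨σ, fun v => (hσ v).1, ?_⟩
  ext v
  simp only [mem_image]
  constructor
  · rintro ⟨w, hw, rfl⟩
    exact (hσ w).2.2 hw
  · intro hv
    refine ⟨σ.symm v, ?_, by simp⟩
    rw [← (hσ _).2]
    simpa using hv

lemma exists_superset_colorful {V ι : Type*} [Fintype V] [DecidableEq V] [DecidableEq ι]
    [Fintype ι] (color : V → ι) (k : ι → ℕ) (B : Finset V)
    (hB : ∀ i, (B.filter fun v => color v = i).card ≤ k i)
    (hk : ∀ i, k i ≤ (univ.filter fun v => color v = i).card) :
    ∃ S : Finset V, B ⊆ S ∧ ∀ i, (S.filter fun v => color v = i).card = k i := by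
  choose S hBS hS hcard using fun i => exists_subsuperset_card_eq
    (filter_subset_filter (fun v => color v = i) (subset_univ B)) (hB i) (hk i)
  have hSc : ∀ i, ∀ v ∈ S i, color v = i := fun i v hv => (mem_filter.1 (hS i hv)).2
  refine ⟨univ.biUnion S, fun v hv => mem_biUnion.2 ⟨color v, mem_univ _, hBS _ (by simp [hv])⟩,
    fun i => ?_⟩
  rw [← hcard i]
  congr 1
  ext v
  simp only [mem_filter, mem_biUnion, mem_univ, true_and]
  constructor
  · rintro ⟨⟨j, hj⟩, rfl⟩
    rwa [hSc j v hj]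
  · exact fun hv => ⟨⟨i, hv⟩, hSc i v hv⟩

lemma filter_color_image_perm {V ι : Type*} [DecidableEq V] [DecidableEq ι] {color : V → ι}
    {π : Equiv.Perm V} (hπ : ∀ v, color (π v) = color v) (S : Finset V) (i : ι) :
    ((S.image π).filter fun v => color v = i).card = (S.filter fun v => color v = i).card := by
  rw [filter_image, card_image_of_injective _ π.injective]
  simp [hπ]

lemma card_colorful_faces_mul_le {V ι P : Type*} [Fintype V] [DecidableEq V] [DecidableEq ι]
    [Fintype ι] [Fintype P] [DecidableEq P] {K : Finset (Finset V)} (hK : IsComplex K)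
    (color : V → ι) (k : ι → ℕ) (κ : P → ι)
    [DecidablePred fun A : Finset V => ∀ i, (A.filter fun v => color v = i).card = k i]
    (hκ : ∀ i, (univ.filter fun p => κ p = i).card = k i)
    (hk : ∀ i, k i ≤ (univ.filter fun v => color v = i).card) :
    (K.filter fun A => ∀ i, (A.filter fun v => color v = i).card = k i).card *
        (Fintype.piFinset fun p => univ.filter fun v => color v = κ p).card ≤
      ((Fintype.piFinset fun p => univ.filter fun v => color v = κ p).filter
        fun x => univ.image x ∈ K).card *
        (univ.filter fun S : Finset V => ∀ i, (S.filter fun v => color v = i).card = k i).card := by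
  set C := univ.filter fun S : Finset V => ∀ i, (S.filter fun v => color v = i).card = k i with hC
  set Y := Fintype.piFinset fun p => univ.filter fun v => color v = κ p with hY
  set F := K.filter fun A => ∀ i, (A.filter fun v => color v = i).card = k i with hF
  set G := univ.filter fun π : Equiv.Perm V => ∀ v, color (π v) = color v with hG
  have hGmem : ∀ π, π ∈ G ↔ ∀ v, color (π v) = color v := fun π => by simp [hG]
  have hGinv : ∀ π ∈ G, π⁻¹ ∈ G := fun π hπ => (hGmem _).2 fun v => by
    rw [← (hGmem π).1 hπ (π⁻¹ v)]
    simp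
  have hGmul : ∀ π ∈ G, ∀ σ ∈ G, π * σ ∈ G := fun π hπ σ hσ => (hGmem _).2 fun v => by
    rw [Equiv.Perm.mul_apply, (hGmem π).1 hπ, (hGmem σ).1 hσ]
  have hGpos : 0 < G.card := card_pos.2 ⟨1, by simp [hGmem]⟩
  have himage : ∀ (π σ : Equiv.Perm V) (S : Finset V),
      (S.image σ).image π = S.image (π * σ) := fun π σ S => by
    rw [image_image]
    rfl
  let orb : Finset V → ℕ := fun S => (G.filter fun π : Equiv.Perm V => S.image π ∈ K).card
  have horb_eq : ∀ S ∈ C, ∀ T ∈ C, orb S = orb T := fun S hS T hT => by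
    obtain ⟨σ, hσ, rfl⟩ := exists_perm_image_eq color (S := S) (T := T) fun i => by
      rw [(mem_filter.1 hS).2 i, (mem_filter.1 hT).2 i]
    have hσG := (hGmem σ).2 hσ
    refine card_bij' (fun π _ => π * σ⁻¹) (fun π _ => π * σ) ?_ ?_ ?_ ?_
    · intro π hπ
      rw [mem_filter] at hπ ⊢
      exact ⟨hGmul _ hπ.1 _ (hGinv _ hσG), by rw [himage]; simpa using hπ.2⟩
    · intro π hπ
      rw [mem_filter] at hπ ⊢
      exact ⟨hGmul _ hπ.1 _ hσG, by rw [← himage]; exact hπ.2⟩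
    · simp
    · simp
  have horb_sum : ∑ S ∈ C, orb S = G.card * F.card := by
    have := sum_card_bipartiteAbove_eq_sum_card_bipartiteBelow (s := C) (t := G)
      fun (S : Finset V) (π : Equiv.Perm V) => S.image π ∈ K
    refine this.trans ?_
    rw [← smul_eq_mul, ← sum_const]
    refine sum_congr rfl fun π hπ => ?_
    have hπc := (hGmem π).1 hπ
    refine card_bij' (fun S _ => S.image π) (fun S _ => S.image (π⁻¹ : Equiv.Perm V)) ?_ ?_ ?_ ?_
    · intro S hS
      simp only [bipartiteBelow, mem_filter, hC, mem_univ, true_and] at hS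
      simp only [hF, mem_filter, filter_color_image_perm hπc]
      exact ⟨hS.2, hS.1⟩
    · intro S hS
      simp only [hF, mem_filter] at hS
      simp only [bipartiteBelow, mem_filter, hC, mem_univ, true_and, himage,
        filter_color_image_perm ((hGmem _).1 (hGinv π hπ))]
      exact ⟨hS.2, by simpa using hS.1⟩
    · intro S _
      simp [himage]
    · intro S _
      simp [himage]
  have horb : ∀ S ∈ C, orb S * C.card = G.card * F.card := fun S hS => by
    rw [← horb_sum, sum_congr rfl fun T hT => horb_eq T hT S hS, sum_const, smul_eq_mul, mul_comm]
  have hlow : ∀ y ∈ Y, G.card * F.card ≤ orb (univ.image y) * C.card := fun y hy => by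
    have hyc : ∀ p, color (y p) = κ p := by simpa [hY] using hy
    obtain ⟨S, hyS, hS⟩ := exists_superset_colorful color k (univ.image y) (fun i => by
      rw [filter_image, ← hκ i]
      simpa only [hyc] using card_image_le) hk
    rw [← horb S (by simp [hC, hS])]
    exact Nat.mul_le_mul_right _ <| card_le_card fun π hπ => by
      rw [mem_filter] at hπ ⊢
      exact ⟨hπ.1, hK _ hπ.2 _ (image_subset_image hyS)⟩
  have hsumY : ∑ y ∈ Y, orb (univ.image y) =
      G.card * (Y.filter fun x => univ.image x ∈ K).card := by
    have := sum_card_bipartiteAbove_eq_sum_card_bipartiteBelow (s := Y) (t := G)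
      fun (y : P → V) (π : Equiv.Perm V) => (univ.image y).image π ∈ K
    refine this.trans ?_
    rw [← smul_eq_mul, ← sum_const]
    refine sum_congr rfl fun π hπ => ?_
    have hπc := (hGmem π).1 hπ
    have hπc' := (hGmem _).1 (hGinv π hπ)
    refine card_bij' (fun y _ => π ∘ y) (fun y _ => (π⁻¹ : Equiv.Perm V) ∘ y) ?_ ?_ ?_ ?_
    · intro y hy
      simp only [bipartiteBelow, mem_filter, hY, Fintype.mem_piFinset, mem_univ, true_and,
        image_image] at hy
      simp only [mem_filter, hY, Fintype.mem_piFinset, mem_univ, true_and, Function.comp_apply, hπc]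
      exact hy
    · intro y hy
      simp only [mem_filter, hY, Fintype.mem_piFinset, mem_univ, true_and] at hy
      simp only [bipartiteBelow, mem_filter, hY, Fintype.mem_piFinset, mem_univ, true_and,
        image_image, Function.comp_apply, hπc']
      refine ⟨hy.1, ?_⟩
      rw [← Function.comp_assoc, ← Equiv.Perm.coe_mul]
      simpa using hy.2
    · intro y _
      ext p
      simp
    · intro y _
      ext p
      simp
  have := sum_le_sum hlow
  rw [sum_const, smul_eq_mul, ← sum_mul, hsumY] at this
  refine Nat.le_of_mul_le_mul_left (c := G.card) ?_ hGpos
  calc G.card * (F.card * Y.card) = Y.card * (G.card * F.card) := by ring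
    _ ≤ _ := this
    _ = _ := by ring

lemma card_colorful_faces_le (c d : ℕ) (k : Fin c → ℕ) {V : Type*} [Fintype V] [DecidableEq V]
    {K : Finset (Finset V)} (hK : IsComplex K) (hcoll : Collapsible d K) (color : V → Fin c)
    (hne : ∀ i, 1 ≤ (univ.filter fun v => color v = i).card)
    (hk : ∀ i, k i ≤ (univ.filter fun v => color v = i).card)
    (β : Fin c → ℝ) (hβ : ∀ i, 0 < β i ∧ β i ≤ 1)
    (hdim : ∀ i, ∀ A ∈ K, (∀ v ∈ A, color v = i) →
      (A.card : ℝ) ≤ β i * ((univ.filter fun v => color v = i).card : ℝ)) :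
    ((K.filter fun A => ∀ i, (A.filter fun v => color v = i).card = k i).card : ℝ) ≤
      alphaK c d k β * ((univ.filter fun S : Finset V =>
        ∀ i, (S.filter fun v => color v = i).card = k i).card : ℝ) := by
  set n : Fin c → ℕ := fun i => (univ.filter fun v => color v = i).card with hn
  have hnpos : ∀ i, (0 : ℝ) < n i := fun i => Nat.cast_pos.2 (hne i)
  set r : Fin c → ℕ := fun i => ⌊β i * n i⌋₊ with hr
  have hrβ : ∀ i, (r i : ℝ) ≤ β i * n i := fun i =>
    Nat.floor_le (mul_nonneg (hβ i).1.le (hnpos i).le)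
  have hrn : ∀ i, r i ≤ n i := fun i => by
    have : (r i : ℝ) ≤ n i :=
      (hrβ i).trans (mul_le_of_le_one_left (hnpos i).le (hβ i).2)
    exact_mod_cast this
  have hseq := card_sequences_le hK hcoll color (fun p : Σ i, Fin (k i) => p.1) r
    (fun i A hA hc => Nat.le_floor (hdim i A hA hc)) hrn
  have hsym := card_colorful_faces_mul_le hK color k (fun p : Σ i, Fin (k i) => p.1)
    (card_sigma_fiber k) hk
  have hY : ((Fintype.piFinset fun p : Σ i, Fin (k i) =>
      univ.filter fun v => color v = p.1).card : ℝ) = ∏ p : Σ i, Fin (k i), (n p.1 : ℝ) := by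
    rw [Fintype.card_piFinset, Nat.cast_prod]
  have hcnt := card_threshold_filter d (fun p : Σ i, Fin (k i) => n p.1) (fun p => r p.1)
    (fun p => hrn p.1) (fun p => hne p.1)
  have hmono : failureExpectation (univ : Finset (Σ i, Fin (k i)))
      (fun m => if m ≤ d then 1 else 0) (fun p => (r p.1 : ℝ) / n p.1) ≤ alphaK c d k β := by
    rw [alphaK_eq_failureExpectation]
    refine failureExpectation_mono _ (fun a b hab => ?_) (fun p => by positivity)
      (fun p => (div_le_iff₀ (hnpos _)).2 (hrβ _)) (fun p => (hβ p.1).2)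
    split_ifs
    · exact le_rfl
    · omega
    · exact zero_le_one
    · exact le_rfl
  have hprod : 0 < ∏ p : Σ i, Fin (k i), (n p.1 : ℝ) := prod_pos fun p _ => hnpos p.1
  have hsym' := (Nat.cast_le (α := ℝ)).2 hsym
  have hseq' := (Nat.cast_le (α := ℝ)).2 hseq
  rw [Nat.cast_mul, Nat.cast_mul, hY] at hsym'
  rw [hcnt] at hseq'
  refine le_of_mul_le_mul_right ?_ hprod
  calc _ ≤ _ := hsym'
    _ ≤ _ := mul_le_mul_of_nonneg_right
      (hseq'.trans (mul_le_mul_of_nonneg_left hmono hprod.le)) (Nat.cast_nonneg _)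
    _ = _ := by ring

end

/-- **Proposition 3.3 (strict version of the `k`-colorful fractional Helly theorem)**.
If a `d`-collapsible complex `K` contains strictly more than
`α_k(d, β) · |binom(N, k)|` `k`-colorful faces, then for some `i` we have
`dim K[N i] > β i · n i - 1`. -/
theorem k_colorful_fractional_helly_strict
    (c d : ℕ) (hc : 1 ≤ c) (hd : 1 ≤ d) (k : Fin c → ℕ)
    {V : Type} [Fintype V] [DecidableEq V]
    (K : Finset (Finset V)) (hK : IsComplex K) (hcoll : Collapsible d K)
    (color : V → Fin c)
    (hne : ∀ i, 1 ≤ (Finset.univ.filter fun v => color v = i).card)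
    (β : Fin c → ℝ) (hβ : ∀ i, 0 < β i ∧ β i ≤ 1)
    (hcount : alphaK c d k β *
        ((Finset.univ.filter fun S : Finset V =>
          ∀ i, (S.filter fun v => color v = i).card = k i).card : ℝ) <
      ((K.filter fun A => ∀ i, (A.filter fun v => color v = i).card = k i).card : ℝ)) :
    ∃ i : Fin c, ∃ A ∈ K, (∀ v ∈ A, color v = i) ∧
      β i * ((Finset.univ.filter fun v => color v = i).card : ℝ) - 1 < (A.card : ℝ) - 1 := by
  by_contra! hdim
  by_cases hk : ∀ i, k i ≤ (Finset.univ.filter fun v => color v = i).card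
  · refine hcount.not_ge (card_colorful_faces_le c d k hK hcoll color hne hk β hβ
      fun i A hA hc => ?_)
    have := hdim i A hA hc
    linarith
  · push Not at hk
    obtain ⟨i, hi⟩ := hk
    have hempty : ∀ S : Finset V, ¬ ∀ i, (S.filter fun v => color v = i).card = k i :=
      fun S hS => by
        have := Finset.card_le_card
          (Finset.filter_subset_filter (fun v => color v = i) (Finset.subset_univ S))
        have := hS i
        omega
    simp [hempty] at hcount
end
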